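/- Let q ≥ 2 be an integer and let I₁, I₂ ⊆ [0,q) be intervals. Then for every integer h and every δ > 0, N_{q,h}(I₁,I₂) = (φ(q)/q²)·|I₁|·|I₂| + O_δ( q^{1/2+δ} · gcd(h,q) ), where the implied constant depends only on δ. -/

import Mathlib

open MeasureTheory Real
open scoped Classical

/-- `N_{q,h}(I₁,I₂) = #{(x,y) ∈ (I₁∩ℤ) × (I₂∩ℤ) : gcd(x,q) = 1, xy ≡ h (mod q)}`,
for intervals `I₁, I₂ ⊆ [0,q)`. -/
noncomputable def Ncong (q : ℕ) (h : ℤ) (I1 I2 : Set ℝ) : ℕ :=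
  ((Finset.range q ×ˢ Finset.range q).filter fun p =>
    ((p.1 : ℝ) ∈ I1 ∧ (p.2 : ℝ) ∈ I2 ∧ Nat.gcd p.1 q = 1 ∧
      ((p.1 : ℤ) * (p.2 : ℤ)) ≡ h [ZMOD (q : ℤ)])).card

open Polynomial in
theorem eq_zero_of_sum_add_pow_mul_eq_zero {F : Type*} [Field F] {p : ℕ} [Fact p.Prime] [CharP F p]
    {n P e D : ℕ} (hP : P = p ^ n) (he : 2 * e = P + 1) {f : F[X]} (hf0 : f.coeff 0 ≠ 0)
    (hsq : ∀ (c : F) (u v : F[X]), c ≠ 0 → u ^ 2 = C c * f * v ^ 2 → v = 0)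
    (hD : 2 * D + f.natDegree ≤ P) (J : ℕ) (u v : ℕ → F[X])
    (hu : ∀ j, (u j).natDegree < D) (hv : ∀ j, (v j).natDegree < D)
    (h : ∑ j ∈ Finset.range J, (u j + f ^ e * v j) * X ^ (j * P) = 0) :
    ∀ j < J, u j = 0 ∧ v j = 0 := by
  induction J generalizing u v with
  | zero => simp
  | succ J ih =>
    rw [Finset.sum_range_succ'] at h
    have hshift : ∑ j ∈ Finset.range J, (u (j + 1) + f ^ e * v (j + 1)) * X ^ ((j + 1) * P)
        = X ^ P * ∑ j ∈ Finset.range J, (u (j + 1) + f ^ e * v (j + 1)) * X ^ (j * P) := by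
      rw [Finset.mul_sum]
      refine Finset.sum_congr rfl fun j _ => ?_
      ring
    rw [hshift] at h
    have hdvd : X ^ P ∣ u 0 + f ^ e * v 0 := by
      refine ⟨-∑ j ∈ Finset.range J, (u (j + 1) + f ^ e * v (j + 1)) * X ^ (j * P), ?_⟩
      simp only [zero_mul, pow_zero, mul_one] at h
      linear_combination h
    have hfP : X ^ P ∣ f ^ P - C (f.coeff 0 ^ P) := by
      have : f ^ P - C (f.coeff 0 ^ P) = (f - C (f.coeff 0)) ^ P := by
        subst hP
        rw [sub_pow_char_pow, C_pow]
      rw [this]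
      exact pow_dvd_pow_of_dvd (X_dvd_iff.2 (by simp)) P
    have h2 : X ^ P ∣ u 0 ^ 2 - C (f.coeff 0 ^ P) * f * v 0 ^ 2 := by
      have : u 0 ^ 2 - C (f.coeff 0 ^ P) * f * v 0 ^ 2
          = (u 0 + f ^ e * v 0) * (u 0 - f ^ e * v 0)
            + (f ^ P - C (f.coeff 0 ^ P)) * (f * v 0 ^ 2) := by
        have : f ^ e * f ^ e = f ^ P * f := by
          rw [← pow_add, ← pow_succ, ← he, two_mul]
        linear_combination (v 0) ^ 2 * this
      rw [this]
      exact dvd_add (hdvd.mul_right _) (hfP.mul_right _)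
    have h3 : u 0 ^ 2 - C (f.coeff 0 ^ P) * f * v 0 ^ 2 = 0 := by
      by_contra hne
      have h4 := natDegree_le_of_dvd h2 hne
      rw [natDegree_X_pow] at h4
      have h5 : (u 0 ^ 2 - C (f.coeff 0 ^ P) * f * v 0 ^ 2).natDegree
          ≤ 2 * (D - 1) + f.natDegree := by
        refine (natDegree_sub_le _ _).trans (max_le ?_ ?_)
        · refine natDegree_pow_le.trans ?_
          have := hu 0
          omega
        · refine natDegree_mul_le.trans ?_
          have h6 := natDegree_C_mul_le (f.coeff 0 ^ P) f
          have h7 : (v 0 ^ 2).natDegree ≤ 2 * (v 0).natDegree := natDegree_pow_le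
          have := hv 0
          omega
      have := hu 0
      omega
    have hv0 : v 0 = 0 := hsq _ _ _ (pow_ne_zero P hf0) (sub_eq_zero.1 h3)
    have hu0 : u 0 = 0 := by
      rw [hv0] at h3
      simpa using h3
    have h8 := ih (fun j => u (j + 1)) (fun j => v (j + 1)) (fun j => hu _) (fun j => hv _) (by
      simp only [hu0, hv0, mul_zero, add_zero, zero_mul] at h
      exact (mul_eq_zero.1 h).resolve_left (pow_ne_zero _ X_ne_zero))
    intro j hj
    cases j with
    | zero => exact ⟨hu0, hv0⟩
    | succ j => exact h8 j (by omega)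

open Polynomial in
theorem card_pow_eq_le {F : Type*} [Field F] [Fintype F] {p : ℕ} [Fact p.Prime] [CharP F p]
    {n P e : ℕ} (hP : P = p ^ n) (he : 2 * e = P + 1) (hF : Fintype.card F = P ^ 2) {f : F[X]}
    (hf0 : f.coeff 0 ≠ 0)
    (hsq : ∀ (c : F) (u v : F[X]), c ≠ 0 → u ^ 2 = C c * f * v ^ 2 → v = 0)
    (hPm : 4 * f.natDegree + 11 ≤ P) (a : F) :
    2 * (Finset.univ.filter fun x => f.eval x ^ ((Fintype.card F - 1) / 2) = a).card
      ≤ P ^ 2 + (6 * f.natDegree + 8) * P := by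
  set m := f.natDegree with hm
  obtain ⟨D, hD⟩ : ∃ D, D = P / 4 := ⟨_, rfl⟩
  obtain ⟨J, hJ⟩ : ∃ J, J = e + (2 * m + 2) := ⟨_, rfl⟩
  obtain ⟨E, hE⟩ : ∃ E, E = P * (D - 1) + J + m * e := ⟨_, rfl⟩
  have hD1 : 4 * D ≤ P := by omega
  have hD2 : P ≤ 4 * D + 3 := by omega
  have hDpos : 0 < D := by omega
  have hEJ : E < 2 * (J * D) := by
    obtain ⟨d, rfl⟩ : ∃ d, D = d + 1 := ⟨D - 1, by omega⟩
    rw [hE, hJ]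
    simp only [Nat.add_sub_cancel]
    have hPe : P = 2 * e - 1 := by omega
    obtain ⟨e', rfl⟩ : ∃ e', e = e' + 1 := ⟨e - 1, by omega⟩
    have : P = 2 * e' + 1 := by omega
    subst this
    have h1 : e' ≤ 2 * d + 3 := by omega
    nlinarith
  let A : (Fin J × Fin D → F) →ₗ[F] F[X] :=
    ∑ k : Fin J × Fin D, (monomial (P * k.2 + k.1)) ∘ₗ (LinearMap.proj k)
  have hA : ∀ w, A w = ∑ k : Fin J × Fin D, monomial (P * k.2 + k.1) (w k) := by
    intro w
    simp [A, LinearMap.sum_apply]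
  let Φ : (Fin J × Fin D → F) × (Fin J × Fin D → F) →ₗ[F] F[X] :=
    LinearMap.coprod A ((LinearMap.mulLeft F (C a * f ^ e)) ∘ₗ A)
  let Ψ : (Fin J × Fin D → F) × (Fin J × Fin D → F) →ₗ[F] (Fin E → F) :=
    LinearMap.pi fun i => (lcoeff F i) ∘ₗ Φ
  have hker : LinearMap.ker Ψ ≠ ⊥ := by
    apply LinearMap.ker_ne_bot_of_finrank_lt
    rw [Module.finrank_prod, Module.finrank_fintype_fun_eq_card, Module.finrank_fintype_fun_eq_card]
    simp only [Fintype.card_fin, Fintype.card_prod]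
    omega
  obtain ⟨w, hw, hw0⟩ := (Submodule.ne_bot_iff _).1 hker
  have hAdeg : ∀ g, (A g).natDegree ≤ P * (D - 1) + (J - 1) := by
    intro g
    rw [hA]
    refine natDegree_sum_le_of_forall_le _ _ fun k _ => ?_
    refine (natDegree_monomial_le _).trans ?_
    have h1 := k.1.2
    have h2 := k.2.2
    have : P * (k.2 : ℕ) ≤ P * (D - 1) := Nat.mul_le_mul_left _ (by omega)
    omega
  have hfe : (f ^ e).natDegree ≤ m * e := by
    rw [mul_comm]; exact natDegree_pow_le
  have hΦ0 : Φ w = 0 := by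
    ext i
    rw [coeff_zero]
    by_cases hi : i < E
    · exact congrFun (LinearMap.mem_ker.1 hw) ⟨i, hi⟩
    · apply coeff_eq_zero_of_natDegree_lt
      have h1 : (Φ w).natDegree ≤ P * (D - 1) + (J - 1) + m * e := by
        refine (natDegree_add_le _ _).trans (max_le ((hAdeg _).trans (by omega)) ?_)
        refine natDegree_mul_le.trans ?_
        have := natDegree_C_mul_le a (f ^ e)
        have : (A (LinearMap.snd F _ _ w)).natDegree ≤ _ := hAdeg w.2
        omega
      omega
  let S : (Fin J × Fin D → F) → ℕ → F[X] := fun g j =>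
    if h : j < J then ∑ i : Fin D, monomial (i : ℕ) (g (⟨j, h⟩, i) ^ P) else 0
  have hSdeg : ∀ g j, (S g j).natDegree < D := by
    intro g j
    have : (S g j).natDegree ≤ D - 1 := by
      simp only [S]
      split_ifs with h
      · refine natDegree_sum_le_of_forall_le _ _ fun k _ => ?_
        refine (natDegree_monomial_le _).trans ?_
        have := k.2
        omega
      · simp
    omega
  let R : F[X] := ∑ j ∈ Finset.range J, (S w.1 j + f ^ e * S w.2 j) * X ^ (j * P)
  have hS0 : ∀ g, (∀ j < J, S g j = 0) → g = 0 := by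
    intro g hg
    ext ⟨j, i⟩
    have := congrArg (fun r => coeff r i) (hg j j.2)
    simp only [S, j.2, dif_pos, finsetSum_coeff, coeff_monomial, coeff_zero] at this
    simp only [Fin.val_inj, Finset.sum_ite_eq', Finset.mem_univ, if_true] at this
    simpa using eq_zero_of_pow_eq_zero this
  have hR : R ≠ 0 := by
    intro hR
    have := eq_zero_of_sum_add_pow_mul_eq_zero hP he hf0 hsq (D := D) (by omega) J _ _
      (hSdeg w.1) (hSdeg w.2) hR
    apply hw0
    exact Prod.ext (hS0 _ fun j hj => (this j hj).1) (hS0 _ fun j hj => (this j hj).2)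
  have hSR : ∀ (g : Fin J × Fin D → F) (x : F),
      (∑ j ∈ Finset.range J, (S g j) * X ^ (j * P)).eval x ^ P = (A g).eval x := by
    intro g x
    have hx : ∀ y : F, (y ^ P) ^ P = y := by
      intro y
      rw [← pow_mul, ← sq, ← hF, FiniteField.pow_card]
    rw [hA, Finset.sum_range, eval_finsetSum, eval_finsetSum, Fintype.sum_prod_type]
    have : ExpChar F p := ExpChar.prime Fact.out
    rw [hP, sum_pow_char_pow, ← hP]
    refine Finset.sum_congr rfl fun j _ => ?_
    simp only [S, j.2, dif_pos, eval_mul, eval_pow, eval_X, eval_finsetSum, eval_monomial]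
    rw [mul_pow, hP, sum_pow_char_pow, ← hP, Finset.sum_mul]
    refine Finset.sum_congr rfl fun i _ => ?_
    rw [mul_pow, hx, pow_add, pow_mul x j P, hx, mul_assoc]
    congr 2
    rw [pow_right_comm, ← pow_mul]
  have hroot : ∀ x, f.eval x ^ ((Fintype.card F - 1) / 2) = a → R.eval x = 0 := by
    intro x hx
    have hRe : R = (∑ j ∈ Finset.range J, (S w.1 j) * X ^ (j * P))
        + f ^ e * ∑ j ∈ Finset.range J, (S w.2 j) * X ^ (j * P) := by
      simp only [R]
      rw [Finset.mul_sum, ← Finset.sum_add_distrib]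
      exact Finset.sum_congr rfl fun j _ => by ring
    have h1 : R.eval x ^ P = (Φ w).eval x := by
      rw [hRe, eval_add, eval_mul]
      have : ExpChar F p := ExpChar.prime Fact.out
      conv_lhs => rw [hP, add_pow_char_pow, ← hP]
      rw [mul_pow, hSR, hSR]
      simp only [Φ, LinearMap.coprod_apply, LinearMap.comp_apply, LinearMap.mulLeft_apply,
        eval_add, eval_mul, eval_C, eval_pow]
      rw [← hx, ← pow_mul, ← pow_add, hF]
      congr 3
      have : P = 2 * e - 1 := by omega
      obtain ⟨e', rfl⟩ : ∃ e', e = e' + 1 := ⟨e - 1, by omega⟩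
      have : P = 2 * e' + 1 := by omega
      subst this
      have : ((2 * e' + 1) ^ 2 - 1) / 2 = 2 * e' ^ 2 + 2 * e' := by
        have : (2 * e' + 1) ^ 2 = 2 * (2 * e' ^ 2 + 2 * e') + 1 := by ring
        omega
      rw [this]
      ring
    rw [hΦ0, eval_zero] at h1
    exact eq_zero_of_pow_eq_zero h1
  have hcard : (Finset.univ.filter fun x => f.eval x ^ ((Fintype.card F - 1) / 2) = a).card
      ≤ R.natDegree := by
    have hsub : (Finset.univ.filter fun x => f.eval x ^ ((Fintype.card F - 1) / 2) = a)
        ⊆ R.roots.toFinset := by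
      intro x hx
      rw [Multiset.mem_toFinset, mem_roots hR]
      exact hroot x (Finset.mem_filter.1 hx).2
    exact (Finset.card_le_card hsub).trans ((Multiset.toFinset_card_le _).trans (card_roots' R))
  have hRdeg : R.natDegree ≤ (D - 1) + m * e + (J - 1) * P := by
    refine natDegree_sum_le_of_forall_le _ _ fun j hj => ?_
    refine natDegree_mul_le.trans ?_
    rw [natDegree_X_pow]
    have hj' := Finset.mem_range.1 hj
    refine Nat.add_le_add ?_ (Nat.mul_le_mul_right _ (by omega))
    refine (natDegree_add_le _ _).trans (max_le ?_ ?_)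
    · have := hSdeg w.1 j
      omega
    · refine natDegree_mul_le.trans ?_
      have := hSdeg w.2 j
      omega
  refine (Nat.mul_le_mul_left 2 (hcard.trans hRdeg)).trans ?_
  obtain ⟨e', rfl⟩ : ∃ e', e = e' + 1 := ⟨e - 1, by omega⟩
  have hPe : P = 2 * e' + 1 := by omega
  have hJ' : J - 1 = e' + (2 * m + 2) := by omega
  rw [hJ']
  have h1 : 2 * (m * (e' + 1)) ≤ 2 * m * P := by rw [hPe]; nlinarith
  have h2 : 2 * (e' * P) ≤ P ^ 2 := by rw [hPe]; nlinarith
  nlinarith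

theorem eq_zero_of_sq_eq_mul_sq {R : Type*} [CommRing R] [IsDomain R]
    [UniqueFactorizationMonoid R] {f u v : R} (hf : Squarefree f) (hfu : ¬ IsUnit f)
    (h : u ^ 2 = f * v ^ 2) : v = 0 := by
  by_contra hv
  have hf0 : f ≠ 0 := hf.ne_zero
  obtain ⟨r, hr, hrf⟩ := WfDvdMonoid.exists_irreducible_factor hfu hf0
  have hrp : Prime r := UniqueFactorizationMonoid.irreducible_iff_prime.1 hr
  have hu : u ≠ 0 := by
    rintro rfl
    simp [hf0, hv] at h
  have h1 : emultiplicity r (u ^ 2) = emultiplicity r (f * v ^ 2) := by rw [h]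
  have hfr : emultiplicity r f = 1 := by
    refine le_antisymm ?_ ?_
    · by_contra hlt
      rw [not_le] at hlt
      have : (2 : ℕ) ≤ emultiplicity r f := by
        have := Order.add_one_le_of_lt hlt
        simpa [one_add_one_eq_two] using this
      have h2 := pow_dvd_of_le_emultiplicity this
      exact hr.not_isUnit (hf r (by rwa [sq] at h2))
    · have := le_emultiplicity_of_pow_dvd (k := 1) (by simpa using hrf)
      simpa using this
  rw [emultiplicity_mul hrp, emultiplicity_pow hrp, emultiplicity_pow hrp, hfr] at h1
  have hfu := (FiniteMultiplicity.of_prime_left hrp hu).emultiplicity_eq_multiplicity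
  have hfv := (FiniteMultiplicity.of_prime_left hrp hv).emultiplicity_eq_multiplicity
  rw [hfu, hfv] at h1
  norm_cast at h1
  omega

open Polynomial in
theorem abs_sum_quadraticChar_le {F : Type*} [Field F] [Fintype F] {p : ℕ} [Fact p.Prime]
    [CharP F p] (hp : p ≠ 2) {n P : ℕ} (hP : P = p ^ n) (hF : Fintype.card F = P ^ 2) {f : F[X]}
    (hf0 : f.coeff 0 ≠ 0) (hf : Squarefree f) (hfd : f.natDegree ≠ 0)
    (hPm : 4 * f.natDegree + 11 ≤ P) :
    |∑ x, quadraticChar F (f.eval x)| ≤ (6 * f.natDegree + 9) * P := by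
  have hPodd : Odd P := hP ▸ ((Fact.out : p.Prime).odd_of_ne_two hp).pow
  obtain ⟨e, he⟩ := hPodd
  have hsq : ∀ (c : F) (u v : F[X]), c ≠ 0 → u ^ 2 = C c * f * v ^ 2 → v = 0 := by
    intro c u v hc h
    have hass : Associated f (C c * f) :=
      ⟨Units.map C.toMonoidHom (Units.mk0 c hc), by simp [mul_comm]⟩
    refine eq_zero_of_sq_eq_mul_sq (f := C c * f) (hass.squarefree_iff.1 hf) ?_ h
    rw [← hass.isUnit_iff]
    exact fun hu => hfd (natDegree_eq_zero_of_isUnit hu)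
  have hF2 : ringChar F ≠ 2 := by
    rw [ringChar.eq F p]; exact hp
  have hb : ∀ a, _ := card_pow_eq_le hP (e := e + 1) (by omega) hF hf0 hsq hPm
  have h1 := hb 1
  have h2 := hb (-1)
  set N1 := (Finset.univ.filter fun x => f.eval x ^ ((Fintype.card F - 1) / 2) = 1) with hN1
  set N2 := (Finset.univ.filter fun x => f.eval x ^ ((Fintype.card F - 1) / 2) = -1) with hN2
  have hcard : (Fintype.card F - 1) / 2 = Fintype.card F / 2 := by
    have := FiniteField.odd_card_of_char_ne_two hF2
    omega
  have hne : (1 : F) ≠ -1 := (Ring.neg_one_ne_one_of_char_ne_two hF2).symm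
  have hsum : ∑ x, quadraticChar F (f.eval x) = (N1.card : ℤ) - N2.card := by
    rw [hN1, hN2, Finset.card_filter, Finset.card_filter]
    push_cast
    rw [← Finset.sum_sub_distrib]
    refine Finset.sum_congr rfl fun x _ => ?_
    by_cases hx : f.eval x = 0
    · have : Fintype.card F / 2 ≠ 0 := by
        have := Fintype.one_lt_card (α := F)
        omega
      rw [hx, hcard, zero_pow this]
      simp
    · rw [quadraticChar_eq_pow_of_char_ne_two hF2 hx, hcard]
      rcases FiniteField.pow_dichotomy hF2 hx with h | h
      · simp [h, hne]
      · simp [h, hne.symm]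
  have hN : P ^ 2 ≤ N1.card + N2.card + f.natDegree := by
    have hf00 : f ≠ 0 := hf.ne_zero
    rw [← hF, ← Finset.card_univ]
    have : (Finset.univ : Finset F) ⊆ N1 ∪ N2 ∪ f.roots.toFinset := by
      intro x _
      rw [Finset.mem_union, Finset.mem_union, Multiset.mem_toFinset, mem_roots hf00]
      by_cases hx : f.eval x = 0
      · exact Or.inr hx
      · left
        rw [hN1, hN2, Finset.mem_filter, Finset.mem_filter, hcard]
        simpa using FiniteField.pow_dichotomy hF2 hx
    refine (Finset.card_le_card this).trans ((Finset.card_union_le _ _).trans ?_)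
    exact Nat.add_le_add (Finset.card_union_le _ _)
      ((Multiset.toFinset_card_le _).trans (card_roots' f))
  rw [hsum]
  have hmP : f.natDegree ≤ P := by omega
  zify at h1 h2 hN hmP
  rw [abs_le]
  constructor <;> nlinarith

theorem card_pow_sub_self_eq {p : ℕ} [Fact p.Prime] {F : Type*} [Field F] [Fintype F]
    [Algebra (ZMod p) F] (z : F) :
    (Finset.univ.filter fun y : F => y ^ p - y = z).card
      = if Algebra.trace (ZMod p) F z = 0 then p else 0 := by
  let L : F →ₗ[ZMod p] F := (FiniteField.frobeniusAlgHom (ZMod p) F).toLinearMap - LinearMap.id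
  have hL : ∀ y, L y = y ^ p - y := by
    intro y
    simp [L, ZMod.card]
  have hcardker : (Finset.univ.filter fun y => L y = 0).card = Fintype.card (LinearMap.ker L) :=
    (Fintype.card_of_subtype _ (by simp)).symm
  have hker : Fintype.card (LinearMap.ker L) ≤ p := by
    have hp1 : 1 < p := (Fact.out : p.Prime).one_lt
    have hne : (Polynomial.X ^ p - Polynomial.X : Polynomial F) ≠ 0 :=
      FiniteField.X_pow_card_sub_X_ne_zero F hp1
    have : (Finset.univ.filter fun y => L y = 0)
        ⊆ (Polynomial.X ^ p - Polynomial.X : Polynomial F).roots.toFinset := by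
      intro y hy
      rw [Multiset.mem_toFinset, Polynomial.mem_roots hne]
      rw [Finset.mem_filter, hL] at hy
      simpa using hy.2
    have h2 := (Finset.card_le_card this).trans ((Multiset.toFinset_card_le _).trans
      (Polynomial.card_roots' _))
    rwa [FiniteField.X_pow_card_sub_X_natDegree_eq F hp1, hcardker] at h2
  have hle : LinearMap.range L ≤ LinearMap.ker (Algebra.trace (ZMod p) F) := by
    rintro _ ⟨y, rfl⟩
    rw [LinearMap.mem_ker, hL, map_sub, sub_eq_zero]
    have := Algebra.trace_eq_of_algEquiv
      (FiniteField.frobeniusAlgEquivOfAlgebraic (ZMod p) F) y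
    simpa [ZMod.card] using this
  have hcard := Module.card_eq_pow_finrank (K := ZMod p) (V := LinearMap.ker L)
  rw [ZMod.card] at hcard
  have hp1 : 1 < p := (Fact.out : p.Prime).one_lt
  have hk1 : Module.finrank (ZMod p) (LinearMap.ker L) ≤ 1 := by
    rw [hcard] at hker
    exact (Nat.pow_le_pow_iff_right hp1).1 (by simpa using hker)
  have hrn := LinearMap.finrank_range_add_finrank_ker L
  have htr := LinearMap.finrank_range_add_finrank_ker (Algebra.trace (ZMod p) F)
  have htop : LinearMap.range (Algebra.trace (ZMod p) F) = ⊤ :=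
    LinearMap.range_eq_top.2 (Algebra.trace_surjective (ZMod p) F)
  rw [htop, finrank_top, Module.finrank_self] at htr
  have hle2 := Submodule.finrank_mono hle
  have heq : LinearMap.range L = LinearMap.ker (Algebra.trace (ZMod p) F) :=
    Submodule.eq_of_le_of_finrank_le hle (by omega)
  have hk : Module.finrank (ZMod p) (LinearMap.ker L) = 1 := by
    rw [heq] at hrn
    omega
  rw [hk, pow_one] at hcard
  split_ifs with h
  · have hz : z ∈ LinearMap.range L := heq ▸ LinearMap.mem_ker.2 h
    obtain ⟨w, hw⟩ := hz
    refine Eq.trans ?_ (hcardker.trans hcard)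
    refine Finset.card_bij (fun y _ => y - w) ?_ ?_ ?_
    · intro y hy
      rw [Finset.mem_filter, ← hL] at hy
      simp [hy.2, hw]
    · intro a _ b _ hab
      simpa using hab
    · intro y hy
      refine ⟨y + w, ?_, by simp⟩
      have hy' : L y = 0 := by simpa using hy
      rw [Finset.mem_filter, ← hL, map_add, hy', hw]
      simp
  · rw [Finset.card_eq_zero, Finset.filter_eq_empty_iff]
    intro y _ hy
    apply h
    rw [← LinearMap.mem_ker, ← heq, ← hy, ← hL]
    exact ⟨y, rfl⟩

theorem card_add_mul_inv_eq {F : Type*} [Field F] [Fintype F] (hF : ringChar F ≠ 2) {b : F}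
    (hb : b ≠ 0) (w : F) :
    (((Finset.univ.erase 0).filter fun x : F => w = x + b * x⁻¹).card : ℤ)
      = quadraticChar F (w ^ 2 - 4 * b) + 1 := by
  rw [← quadraticChar_card_sqrts hF]
  norm_cast
  have h2 : (2 : F) ≠ 0 := Ring.two_ne_zero hF
  refine Finset.card_bij (fun x _ => 2 * x - w) ?_ ?_ ?_
  · intro x hx
    simp only [Finset.mem_filter, Finset.mem_erase, Finset.mem_univ, and_true] at hx
    obtain ⟨hx0, hx⟩ := hx
    simp only [Set.mem_toFinset, Set.mem_ofPred_eq]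
    have : w * x = x ^ 2 + b := by
      rw [hx]; field_simp
    linear_combination (-4) * this
  · intro x _ y _ hxy
    have : 2 * x = 2 * y := by linear_combination hxy
    exact mul_left_cancel₀ h2 this
  · intro y hy
    simp only [Set.mem_toFinset, Set.mem_ofPred_eq] at hy
    have hx : ((y + w) / 2) ^ 2 - w * ((y + w) / 2) + b = 0 := by
      field_simp
      linear_combination hy
    have hx0 : (y + w) / 2 ≠ 0 := by
      intro h
      rw [h] at hx
      apply hb
      linear_combination hx
    refine ⟨(y + w) / 2, ?_, by field_simp; ring⟩
    simp only [Finset.mem_filter, Finset.mem_erase, Finset.mem_univ, and_true]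
    refine ⟨hx0, ?_⟩
    generalize (y + w) / 2 = x at hx hx0
    field_simp
    linear_combination -hx

open Polynomial in
theorem squarefree_sq_sub_C {p : ℕ} [Fact p.Prime] {F : Type*} [Field F] [CharP F p]
    (hp : p ≠ 2) {c : F} (hc : c ≠ 0) : Squarefree ((X ^ p - X) ^ 2 - C c : F[X]) := by
  apply Polynomial.Separable.squarefree
  have h2 : (2 : F) ≠ 0 := Ring.two_ne_zero (by rwa [ringChar.eq F p])
  have hd : derivative ((X ^ p - X) ^ 2 - C c : F[X]) = -2 * (X ^ p - X) := by
    simp [derivative_pow, C_ofNat]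
  refine ⟨-C c⁻¹, -C (c⁻¹ / 2) * (X ^ p - X), ?_⟩
  rw [hd]
  have h3 : C (c⁻¹ / 2) * 2 = (C c⁻¹ : F[X]) := by
    rw [← C_ofNat, ← C_mul]
    congr 1
    field_simp
  have h4 : C c⁻¹ * C c = (1 : F[X]) := by
    rw [← C_mul, inv_mul_cancel₀ hc, C_1]
  linear_combination ((X ^ p - X) ^ 2) * h3 + h4

theorem norm_sum_addChar_trace_le {p : ℕ} [Fact p.Prime] (hp : p ≠ 2) {F : Type*} [Field F]
    [Fintype F] [Algebra (ZMod p) F] {n P : ℕ} (hP : P = p ^ n) (hF : Fintype.card F = P ^ 2)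
    (hPm : 8 * p + 11 ≤ P) {b : ZMod p} (hb : b ≠ 0) {ψ : AddChar (ZMod p) ℂ} (hψ : ψ ≠ 1) :
    ‖∑ a ∈ Finset.univ.erase (0 : ZMod p), ∑ x ∈ Finset.univ.erase (0 : F),
      ψ (a * Algebra.trace (ZMod p) F x + (a * b) * Algebra.trace (ZMod p) F x⁻¹)‖
      ≤ (12 * p + 10) * P := by
  have : CharP F p := charP_of_injective_algebraMap (algebraMap (ZMod p) F).injective p
  have hF2 : ringChar F ≠ 2 := by rwa [ringChar.eq F p]
  have hp1 : 1 < p := (Fact.out : p.Prime).one_lt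
  set B : F := algebraMap (ZMod p) F b with hB
  have hB0 : B ≠ 0 := by simpa [hB] using hb
  have htr : ∀ a x, a * Algebra.trace (ZMod p) F x + (a * b) * Algebra.trace (ZMod p) F x⁻¹
      = a * Algebra.trace (ZMod p) F (x + B * x⁻¹) := by
    intro a x
    rw [map_add, hB, ← Algebra.smul_def, map_smul, smul_eq_mul]
    ring
  simp only [htr]
  have htot : ∑ a : ZMod p, ∑ x ∈ Finset.univ.erase (0 : F),
      ψ (a * Algebra.trace (ZMod p) F (x + B * x⁻¹))
      = ((∑ y : F, (quadraticChar F ((y ^ p - y) ^ 2 - 4 * B) + 1) : ℤ) : ℂ) := by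
    rw [Finset.sum_comm]
    have h1 : ∀ x : F, ∑ a : ZMod p, ψ (a * Algebra.trace (ZMod p) F (x + B * x⁻¹))
        = ((∑ y : F, if y ^ p - y = x + B * x⁻¹ then 1 else 0 : ℤ) : ℂ) := by
      intro x
      rw [AddChar.sum_mulShift _ (AddChar.IsPrimitive.of_ne_one hψ), ZMod.card]
      have := card_pow_sub_self_eq (p := p) (x + B * x⁻¹)
      rw [Finset.card_filter] at this
      rw [← Nat.cast_inj (R := ℂ)] at this
      push_cast at this ⊢
      rw [this]
    simp only [h1]
    rw [← Int.cast_sum, Finset.sum_comm]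
    congr 1
    refine Finset.sum_congr rfl fun y _ => ?_
    rw [← card_add_mul_inv_eq hF2 hB0, Finset.card_filter]
    push_cast
    rfl
  have hsplit := Finset.add_sum_erase Finset.univ (fun a : ZMod p =>
    ∑ x ∈ Finset.univ.erase (0 : F), ψ (a * Algebra.trace (ZMod p) F (x + B * x⁻¹)))
    (Finset.mem_univ 0)
  rw [htot] at hsplit
  have hzero : ∑ x ∈ Finset.univ.erase (0 : F),
      ψ (0 * Algebra.trace (ZMod p) F (x + B * x⁻¹)) = (P : ℂ) ^ 2 - 1 := by
    simp only [zero_mul, AddChar.map_zero_eq_one, Finset.sum_const, nsmul_eq_mul, mul_one]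
    rw [Finset.card_erase_of_mem (Finset.mem_univ _), Finset.card_univ, hF, Nat.cast_sub]
    · push_cast; rfl
    · exact Nat.one_le_pow _ _ (by omega)
  rw [hzero, Finset.sum_add_distrib, Finset.sum_const, Finset.card_univ, hF] at hsplit
  have hf0 : ((Polynomial.X ^ p - Polynomial.X) ^ 2 - Polynomial.C (4 * B)
      : Polynomial F).coeff 0 ≠ 0 := by
    rw [Polynomial.coeff_zero_eq_eval_zero]
    have h2 : (2 : F) ≠ 0 := Ring.two_ne_zero hF2
    have h4 : (4 : F) ≠ 0 := by
      have : (4 : F) = 2 * 2 := by norm_num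
      rw [this]; exact mul_ne_zero h2 h2
    simp [hB0, h4, show p ≠ 0 by omega]
  have hdeg : ((Polynomial.X ^ p - Polynomial.X) ^ 2 - Polynomial.C (4 * B)
      : Polynomial F).natDegree = 2 * p := by
    rw [Polynomial.natDegree_sub_C, Polynomial.natDegree_pow,
      FiniteField.X_pow_card_sub_X_natDegree_eq F hp1]
  have hmain := abs_sum_quadraticChar_le hp hP hF hf0 (squarefree_sq_sub_C hp (by
    have h2 : (2 : F) ≠ 0 := Ring.two_ne_zero hF2
    have h4 : (4 : F) = 2 * 2 := by norm_num
    rw [h4]; exact mul_ne_zero (mul_ne_zero h2 h2) hB0)) (by omega) (by omega)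
  rw [hdeg] at hmain
  simp only [Polynomial.eval_sub, Polynomial.eval_pow, Polynomial.eval_X,
    Polynomial.eval_C] at hmain
  set T : ℤ := ∑ y : F, quadraticChar F ((y ^ p - y) ^ 2 - 4 * B) with hT
  have hval : ∑ a ∈ Finset.univ.erase (0 : ZMod p), ∑ x ∈ Finset.univ.erase (0 : F),
      ψ (a * Algebra.trace (ZMod p) F (x + B * x⁻¹)) = ((T + 1 : ℤ) : ℂ) := by
    push_cast at hsplit ⊢
    simp only [nsmul_eq_mul, mul_one] at hsplit
    push_cast at hsplit
    linear_combination hsplit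
  rw [hval, Complex.norm_intCast]
  have h5 : |T + 1| ≤ (12 * p + 10) * P := by
    have h6 := abs_add_le T 1
    have h7 : (1 : ℤ) ≤ P := by
      have : 1 ≤ P := by omega
      exact_mod_cast this
    simp only [abs_one] at h6
    push_cast at hmain
    nlinarith
  exact_mod_cast h5

/-- The multiplicative weight on monic polynomials `g = ∏ (X - t)` given by
`ψ (a * ∑ t + c * ∑ t⁻¹)`, and zero if `0` is a root. -/
noncomputable def kloostermanWeight {K : Type*} [Field K] (ψ : AddChar K ℂ) (a c : K)
    (g : Polynomial K) : ℂ :=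
  if g.coeff 0 = 0 then 0 else ψ (-(a * g.nextCoeff + c * (g.coeff 1 / g.coeff 0)))

/-- The finite set of monic polynomials of degree `d` over a finite field. -/
noncomputable def monicFinset (K : Type*) [Field K] [Fintype K] (d : ℕ) : Finset (Polynomial K) :=
  Finset.univ.image fun v : Fin d → K => Polynomial.X ^ d + ∑ i : Fin d, Polynomial.monomial (i : ℕ) (v i)

/-- The monic irreducible polynomials of degree between `1` and `d`. -/
noncomputable def monicIrreducibles (K : Type*) [Field K] [Fintype K] (d : ℕ) :
    Finset (Polynomial K) :=
  ((Finset.Icc 1 d).biUnion (monicFinset K)).filter Irreducible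

section monicFinset

open Polynomial

variable {K : Type*} [Field K]

theorem degree_sum_monomial_lt {d : ℕ} (v : Fin d → K) :
    (∑ i : Fin d, monomial (i : ℕ) (v i)).degree < d := by
  rw [← mem_degreeLT]
  exact Submodule.sum_mem _ fun i _ => mem_degreeLT.2
    ((degree_monomial_le _ _).trans_lt (by exact_mod_cast i.2))

theorem coeff_sum_monomial {d : ℕ} (v : Fin d → K) (i : Fin d) :
    (X ^ d + ∑ i : Fin d, monomial (i : ℕ) (v i)).coeff i = v i := by
  rw [coeff_add, coeff_X_pow, if_neg i.2.ne, zero_add, finsetSum_coeff]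
  simp [coeff_monomial, Fin.val_inj]

variable [Fintype K]

theorem mem_monicFinset {d : ℕ} {g : K[X]} :
    g ∈ monicFinset K d ↔ g.Monic ∧ g.natDegree = d := by
  rw [monicFinset, Finset.mem_image]
  constructor
  · rintro ⟨v, -, rfl⟩
    refine ⟨monic_X_pow_add (degree_sum_monomial_lt v), ?_⟩
    apply natDegree_eq_of_degree_eq_some
    rw [degree_add_eq_left_of_degree_lt, degree_X_pow]
    rw [degree_X_pow]
    exact degree_sum_monomial_lt v
  · rintro ⟨hg, rfl⟩
    refine ⟨fun i => g.coeff i, Finset.mem_univ _, ?_⟩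
    conv_rhs => rw [hg.as_sum, Finset.sum_range]
    simp [C_mul_X_pow_eq_monomial]

theorem sum_monicFinset (d : ℕ) (G : K[X] → ℂ) :
    ∑ g ∈ monicFinset K d, G g
      = ∑ v : Fin d → K, G (X ^ d + ∑ i : Fin d, monomial (i : ℕ) (v i)) := by
  rw [monicFinset, Finset.sum_image]
  intro v _ w _ h
  ext i
  rw [← coeff_sum_monomial v i, ← coeff_sum_monomial w i]
  exact congrArg (fun r => coeff r i) h

theorem mem_monicIrreducibles {d : ℕ} {g : K[X]} :
    g ∈ monicIrreducibles K d ↔ g.Monic ∧ Irreducible g ∧ g.natDegree ≤ d := by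
  rw [monicIrreducibles, Finset.mem_filter, Finset.mem_biUnion]
  constructor
  · rintro ⟨⟨m, hm, hg⟩, hi⟩
    rw [mem_monicFinset] at hg
    rw [Finset.mem_Icc] at hm
    exact ⟨hg.1, hi, hg.2 ▸ hm.2⟩
  · rintro ⟨hm, hi, hd⟩
    exact ⟨⟨_, Finset.mem_Icc.2 ⟨hi.natDegree_pos, hd⟩, mem_monicFinset.2 ⟨hm, rfl⟩⟩, hi⟩

theorem natDegree_eq_sum_monicIrreducibles {d : ℕ} {g : K[X]} (hg : g ∈ monicFinset K d) :
    d = ∑ P ∈ monicIrreducibles K d, ∑ k ∈ Finset.Icc 1 d, if P ^ k ∣ g then P.natDegree else 0 := by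
  obtain ⟨hm, rfl⟩ := mem_monicFinset.1 hg
  have hg0 : g ≠ 0 := hm.ne_zero
  have hinner : ∀ P ∈ monicIrreducibles K g.natDegree,
      (∑ k ∈ Finset.Icc 1 g.natDegree, if P ^ k ∣ g then P.natDegree else 0)
        = (UniqueFactorizationMonoid.normalizedFactors g).count P * P.natDegree := by
    intro P hP
    obtain ⟨hPm, hPi, hPd⟩ := mem_monicIrreducibles.1 hP
    have hmul := UniqueFactorizationMonoid.emultiplicity_eq_count_normalizedFactors hPi hg0
    rw [hPm.normalize_eq_self] at hmul
    have hdvd : ∀ k, P ^ k ∣ g ↔ k ≤ (UniqueFactorizationMonoid.normalizedFactors g).count P := by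
      intro k
      rw [pow_dvd_iff_le_emultiplicity, hmul]
      norm_cast
    have hc : (UniqueFactorizationMonoid.normalizedFactors g).count P ≤ g.natDegree := by
      have h1 := natDegree_le_of_dvd ((hdvd _).2 le_rfl) hg0
      rw [natDegree_pow] at h1
      have := hPi.natDegree_pos
      nlinarith
    rw [← Finset.sum_filter, Finset.sum_const, smul_eq_mul]
    congr 1
    have : Finset.filter (fun k => P ^ k ∣ g) (Finset.Icc 1 g.natDegree)
        = Finset.Icc 1 ((UniqueFactorizationMonoid.normalizedFactors g).count P) := by
      ext k
      simp only [Finset.mem_filter, Finset.mem_Icc, hdvd]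
      omega
    rw [this, Nat.card_Icc]
    omega
  rw [Finset.sum_congr rfl hinner]
  have hprod : (UniqueFactorizationMonoid.normalizedFactors g).prod = g := by
    have h1 := UniqueFactorizationMonoid.prod_normalizedFactors_eq hg0
    rw [h1, hm.normalize_eq_self]
  have hdeg : g.natDegree = ((UniqueFactorizationMonoid.normalizedFactors g).map natDegree).sum := by
    conv_lhs => rw [← hprod]
    apply natDegree_multiset_prod_of_monic
    intro P hP
    exact ((Polynomial.mem_normalizedFactors_iff hg0).1 hP).2.1
  conv_lhs => rw [hdeg]
  rw [Finset.sum_multiset_map_count]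
  refine Finset.sum_subset ?_ ?_
  · intro P hP
    rw [Multiset.mem_toFinset, Polynomial.mem_normalizedFactors_iff hg0] at hP
    exact mem_monicIrreducibles.2 ⟨hP.2.1, hP.1, natDegree_le_of_dvd hP.2.2 hg0⟩
  · intro P _ hP
    rw [Multiset.mem_toFinset, ← Multiset.count_eq_zero] at hP
    rw [hP, zero_smul]

theorem sum_monicFinset_dvd {d : ℕ} {lam : K[X] → ℂ}
    (hmul : ∀ g h : K[X], g.Monic → h.Monic → lam (g * h) = lam g * lam h) (hone : lam 1 = 1)
    {P : K[X]} (hP : P.Monic) (k : ℕ) :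
    (∑ g ∈ (monicFinset K d).filter (P ^ k ∣ ·), lam g)
      = if P.natDegree * k ≤ d then
          lam P ^ k * ∑ g ∈ monicFinset K (d - P.natDegree * k), lam g else 0 := by
  have hPk : (P ^ k).Monic := hP.pow k
  have hdegk : (P ^ k).natDegree = P.natDegree * k := by rw [natDegree_pow, mul_comm]
  have hlamk : lam (P ^ k) = lam P ^ k := by
    induction k with
    | zero => simpa using hone
    | succ k ih =>
      have := ih (hP.pow k) (by rw [natDegree_pow, mul_comm])
      rw [pow_succ, hmul _ _ (hP.pow k) hP, this, pow_succ]
  split_ifs with h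
  · rw [Finset.mul_sum]
    symm
    refine Finset.sum_bij (fun g _ => P ^ k * g) ?_ ?_ ?_ ?_
    · intro g hg
      rw [mem_monicFinset] at hg
      rw [Finset.mem_filter, mem_monicFinset]
      refine ⟨⟨hPk.mul hg.1, ?_⟩, dvd_mul_right _ _⟩
      rw [hPk.natDegree_mul hg.1, hdegk, hg.2]
      omega
    · intro g _ g' _ hgg
      exact mul_left_cancel₀ hPk.ne_zero hgg
    · intro g hg
      rw [Finset.mem_filter, mem_monicFinset] at hg
      obtain ⟨⟨hgm, hgd⟩, r, rfl⟩ := hg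
      have hr : r.Monic := hPk.of_mul_monic_left hgm
      refine ⟨r, ?_, rfl⟩
      rw [mem_monicFinset]
      refine ⟨hr, ?_⟩
      rw [hPk.natDegree_mul hr, hdegk] at hgd
      omega
    · intro g hg
      rw [hmul _ _ hPk (mem_monicFinset.1 hg).1, hlamk]
  · rw [Finset.sum_eq_zero]
    intro g hg
    rw [Finset.mem_filter, mem_monicFinset] at hg
    have := natDegree_le_of_dvd hg.2 hg.1.1.ne_zero
    omega

/-- The logarithmic derivative of the Euler product of a completely multiplicative function on
monic polynomials. -/
theorem natCast_mul_sum_monicFinset {lam : K[X] → ℂ}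
    (hmul : ∀ g h : K[X], g.Monic → h.Monic → lam (g * h) = lam g * lam h) (hone : lam 1 = 1)
    (d : ℕ) :
    d * ∑ g ∈ monicFinset K d, lam g
      = ∑ n ∈ Finset.Icc 1 d, (∑ P ∈ monicIrreducibles K d, ∑ k ∈ Finset.Icc 1 d,
          if P.natDegree * k = n then P.natDegree * lam P ^ k else 0)
            * ∑ g ∈ monicFinset K (d - n), lam g := by
  have hR : ∑ n ∈ Finset.Icc 1 d, (∑ P ∈ monicIrreducibles K d, ∑ k ∈ Finset.Icc 1 d,
          if P.natDegree * k = n then P.natDegree * lam P ^ k else 0)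
            * ∑ g ∈ monicFinset K (d - n), lam g
      = ∑ P ∈ monicIrreducibles K d, ∑ k ∈ Finset.Icc 1 d, P.natDegree *
          (if P.natDegree * k ≤ d then
          lam P ^ k * ∑ g ∈ monicFinset K (d - P.natDegree * k), lam g else 0) := by
    simp only [Finset.sum_mul]
    rw [Finset.sum_comm]
    refine Finset.sum_congr rfl fun P hP => ?_
    rw [Finset.sum_comm]
    refine Finset.sum_congr rfl fun k hk => ?_
    simp only [ite_mul, zero_mul]
    rw [Finset.sum_ite_eq]
    have h1 := (mem_monicIrreducibles.1 hP).2.1.natDegree_pos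
    have h2 := (Finset.mem_Icc.1 hk).1
    have h3 : 1 ≤ P.natDegree * k := Nat.mul_pos h1 h2
    simp only [Finset.mem_Icc, h3, true_and]
    split_ifs <;> ring
  rw [hR, Finset.mul_sum]
  have hL : ∀ g ∈ monicFinset K d, (d : ℂ) * lam g = ∑ P ∈ monicIrreducibles K d,
      ∑ k ∈ Finset.Icc 1 d, P.natDegree * (if P ^ k ∣ g then lam g else 0) := by
    intro g hg
    conv_lhs => rw [natDegree_eq_sum_monicIrreducibles hg]
    push_cast
    simp only [Finset.sum_mul]
    refine Finset.sum_congr rfl fun P hP => Finset.sum_congr rfl fun k hk => ?_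
    split_ifs <;> simp
  rw [Finset.sum_congr rfl hL, Finset.sum_comm]
  refine Finset.sum_congr rfl fun P hP => ?_
  rw [Finset.sum_comm]
  refine Finset.sum_congr rfl fun k hk => ?_
  rw [← Finset.mul_sum, ← Finset.sum_filter,
    sum_monicFinset_dvd hmul hone (mem_monicIrreducibles.1 hP).1]

theorem card_minpoly_eq {L : Type*} [Field L] [Fintype L] [Algebra K L] {P : K[X]}
    (hP : P.Monic) (hPi : Irreducible P) :
    (Finset.univ.filter fun x : L => minpoly K x = P).card
      = if P.natDegree ∣ Module.finrank K L then P.natDegree else 0 := by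
  have hcard : Nat.card L = Nat.card K ^ Module.finrank K L := by
    rw [Nat.card_eq_fintype_card, Nat.card_eq_fintype_card, Module.card_eq_pow_finrank (K := K)]
  split_ifs with h
  · rw [hPi.natDegree_dvd_iff_dvd_X_pow_card_pow_sub_X, ← hcard] at h
    have hne : (X ^ Nat.card L - X : L[X]) ≠ 0 := by
      rw [Nat.card_eq_fintype_card]
      exact FiniteField.X_pow_card_sub_X_ne_zero L Fintype.one_lt_card
    have hsplit : (P.map (algebraMap K L)).Splits := by
      have h1 : (X ^ Nat.card L - X : L[X]).Splits := by
        simpa using Polynomial.splits_X_pow_nat_card_sub_X (K := L)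
      refine h1.of_dvd hne ?_
      have := Polynomial.map_dvd (algebraMap K L) h
      simpa using this
    have hsep : P.Separable := PerfectField.separable_of_irreducible hPi
    rw [← card_rootSet_eq_natDegree hsep hsplit, ← Set.toFinset_card]
    congr 1
    ext x
    simp only [Finset.mem_filter, Finset.mem_univ, true_and, Set.mem_toFinset,
      mem_rootSet_of_ne hP.ne_zero]
    constructor
    · rintro rfl
      exact minpoly.aeval K x
    · intro hx
      exact (minpoly.eq_of_irreducible_of_monic hPi hx hP).symm
  · rw [Finset.card_eq_zero, Finset.filter_eq_empty_iff]
    rintro x - rfl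
    exact h (minpoly.degree_dvd (Algebra.IsIntegral.isIntegral x))

theorem sum_minpoly_eq {L : Type*} [Field L] [Fintype L] [Algebra K L] (lam : K[X] → ℂ) {d : ℕ}
    (hd : Module.finrank K L ≤ d) :
    ∑ x : L, lam (minpoly K x) ^ (Module.finrank K L / (minpoly K x).natDegree)
      = ∑ P ∈ monicIrreducibles K d, ∑ k ∈ Finset.Icc 1 d,
          if P.natDegree * k = Module.finrank K L then P.natDegree * lam P ^ k else 0 := by
  have hn : 0 < Module.finrank K L := Module.finrank_pos
  rw [← Finset.sum_fiberwise_of_maps_to (t := monicIrreducibles K d) (g := fun x => minpoly K x)]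
  · refine Finset.sum_congr rfl fun P hP => ?_
    obtain ⟨hPm, hPi, hPd⟩ := mem_monicIrreducibles.1 hP
    have h1 : ∀ x ∈ Finset.univ.filter (fun x : L => minpoly K x = P),
        lam (minpoly K x) ^ (Module.finrank K L / (minpoly K x).natDegree)
          = lam P ^ (Module.finrank K L / P.natDegree) := by
      intro x hx
      rw [(Finset.mem_filter.1 hx).2]
    rw [Finset.sum_congr rfl h1, Finset.sum_const, card_minpoly_eq hPm hPi, nsmul_eq_mul]
    have hpos := hPi.natDegree_pos
    split_ifs with h
    · obtain ⟨k, hk⟩ := h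
      rw [hk, Nat.mul_div_cancel_left _ hpos]
      have hk0 : 1 ≤ k := by
        rcases Nat.eq_zero_or_pos k with rfl | h
        · omega
        · exact h
      have hkd : k ≤ d := by nlinarith
      rw [Finset.sum_eq_single k]
      · simp
      · intro l _ hl
        rw [if_neg]
        intro h
        exact hl (Nat.eq_of_mul_eq_mul_left hpos h)
      · intro h
        exact absurd (Finset.mem_Icc.2 ⟨hk0, hkd⟩) h
    · rw [Finset.sum_eq_zero]
      · simp
      · intro k _
        rw [if_neg]
        intro hk
        exact h ⟨k, hk.symm⟩
  · intro x _
    have hx := Algebra.IsIntegral.isIntegral (R := K) x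
    exact mem_monicIrreducibles.2 ⟨minpoly.monic hx, minpoly.irreducible hx,
      (Nat.le_of_dvd hn (minpoly.degree_dvd hx)).trans hd⟩

end monicFinset

section kloostermanWeight

open Polynomial

variable {K : Type*} [Field K]

theorem kloostermanWeight_mul (ψ : AddChar K ℂ) (a c : K) {g h : K[X]} (hg : g.Monic)
    (hh : h.Monic) :
    kloostermanWeight ψ a c (g * h) = kloostermanWeight ψ a c g * kloostermanWeight ψ a c h := by
  unfold kloostermanWeight
  rw [mul_coeff_zero]
  by_cases h1 : g.coeff 0 = 0
  · simp [h1]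
  by_cases h2 : h.coeff 0 = 0
  · simp [h2]
  rw [if_neg (mul_ne_zero h1 h2), if_neg h1, if_neg h2, ← AddChar.map_add_eq_mul,
    hg.nextCoeff_mul hh, mul_coeff_one]
  congr 1
  field_simp
  ring

theorem kloostermanWeight_one (ψ : AddChar K ℂ) (a c : K) : kloostermanWeight ψ a c 1 = 1 := by
  simp [kloostermanWeight, coeff_one, nextCoeff]

theorem minpoly_inv_eq {L : Type*} [Field L] [Algebra K L] [FiniteDimensional K L] {x : L}
    (hx : x ≠ 0) :
    minpoly K x⁻¹ = C ((minpoly K x).coeff 0)⁻¹ * (minpoly K x).reverse := by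
  have hxi := Algebra.IsIntegral.isIntegral (R := K) x
  have hc : (minpoly K x).coeff 0 ≠ 0 := minpoly.coeff_zero_ne_zero hxi hx
  have htr : (minpoly K x).natTrailingDegree = 0 := natTrailingDegree_eq_zero.2 (Or.inr hc)
  have hdeg : (minpoly K x).reverse.natDegree = (minpoly K x).natDegree := by
    rw [reverse_natDegree, htr, Nat.sub_zero]
  have hmon : (C ((minpoly K x).coeff 0)⁻¹ * (minpoly K x).reverse).Monic := by
    apply monic_C_mul_of_mul_leadingCoeff_eq_one
    rw [reverse_leadingCoeff, trailingCoeff, htr, inv_mul_cancel₀ hc]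
  have hroot : aeval x⁻¹ (C ((minpoly K x).coeff 0)⁻¹ * (minpoly K x).reverse) = 0 := by
    rw [map_mul]
    have : aeval x⁻¹ (minpoly K x).reverse = 0 := by
      let _ : Invertible x := invertibleOfNonzero hx
      have := (eval₂_reverse_eq_zero_iff (algebraMap K L) x (minpoly K x)).2 (minpoly.aeval K x)
      rwa [invOf_eq_inv] at this
    rw [this, mul_zero]
  have hadj : IntermediateField.adjoin K {x⁻¹} = IntermediateField.adjoin K {x} := by
    apply le_antisymm
    · rw [IntermediateField.adjoin_simple_le_iff]
      exact inv_mem (IntermediateField.mem_adjoin_simple_self K x)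
    · rw [IntermediateField.adjoin_simple_le_iff]
      simpa using inv_mem (IntermediateField.mem_adjoin_simple_self K x⁻¹)
  have hxi' := Algebra.IsIntegral.isIntegral (R := K) x⁻¹
  refine (eq_of_monic_of_dvd_of_natDegree_le (minpoly.monic hxi') hmon
    (minpoly.dvd K x⁻¹ hroot) ?_).symm
  rw [natDegree_C_mul (inv_ne_zero hc), hdeg, ← IntermediateField.adjoin.finrank hxi,
    ← IntermediateField.adjoin.finrank hxi', hadj]

theorem kloostermanWeight_minpoly_pow {L : Type*} [Field L] [Algebra K L] [FiniteDimensional K L]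
    (ψ : AddChar K ℂ) (a c : K) {x : L} (hx : x ≠ 0) :
    kloostermanWeight ψ a c (minpoly K x) ^ (Module.finrank K L / (minpoly K x).natDegree)
      = ψ (a * Algebra.trace K L x + c * Algebra.trace K L x⁻¹) := by
  have hxi := Algebra.IsIntegral.isIntegral (R := K) x
  have hc : (minpoly K x).coeff 0 ≠ 0 := minpoly.coeff_zero_ne_zero hxi hx
  have hpos := minpoly.natDegree_pos hxi
  have hfr : Module.finrank K L / (minpoly K x).natDegree
      = Module.finrank (IntermediateField.adjoin K {x}) L := by
    rw [← Module.finrank_mul_finrank K (IntermediateField.adjoin K {x}) L,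
      IntermediateField.adjoin.finrank hxi, Nat.mul_div_cancel_left _ hpos]
  have hadj : IntermediateField.adjoin K {x⁻¹} = IntermediateField.adjoin K {x} := by
    apply le_antisymm
    · rw [IntermediateField.adjoin_simple_le_iff]
      exact inv_mem (IntermediateField.mem_adjoin_simple_self K x)
    · rw [IntermediateField.adjoin_simple_le_iff]
      simpa using inv_mem (IntermediateField.mem_adjoin_simple_self K x⁻¹)
  have htr : (minpoly K x).natTrailingDegree = 0 := natTrailingDegree_eq_zero.2 (Or.inr hc)
  have hdeg : (minpoly K x).reverse.natDegree = (minpoly K x).natDegree := by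
    rw [reverse_natDegree, htr, Nat.sub_zero]
  have hnext : (minpoly K x⁻¹).nextCoeff = (minpoly K x).coeff 1 / (minpoly K x).coeff 0 := by
    rw [minpoly_inv_eq hx, nextCoeff_C_mul, nextCoeff_of_natDegree_pos (by rw [hdeg]; exact hpos),
      hdeg, coeff_reverse, revAt_le (Nat.sub_le _ _), Nat.sub_sub_self hpos]
    ring
  rw [kloostermanWeight, if_neg hc, hfr, ← AddChar.map_nsmul_eq_pow,
    trace_eq_finrank_mul_minpoly_nextCoeff, trace_eq_finrank_mul_minpoly_nextCoeff, hadj, hnext]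
  congr 1
  rw [nsmul_eq_mul]
  ring

theorem sum_kloostermanWeight_minpoly {L : Type*} [Field L] [Fintype L] [Algebra K L]
    [FiniteDimensional K L]
    (ψ : AddChar K ℂ) (a c : K) :
    ∑ x : L, kloostermanWeight ψ a c (minpoly K x) ^
        (Module.finrank K L / (minpoly K x).natDegree)
      = ∑ x ∈ Finset.univ.erase (0 : L),
          ψ (a * Algebra.trace K L x + c * Algebra.trace K L x⁻¹) := by
  rw [← Finset.add_sum_erase _ _ (Finset.mem_univ (0 : L)), minpoly.zero, natDegree_X, Nat.div_one]
  rw [show kloostermanWeight ψ a c X = 0 by simp [kloostermanWeight],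
    zero_pow Module.finrank_pos.ne', zero_add]
  exact Finset.sum_congr rfl fun x hx =>
    kloostermanWeight_minpoly_pow ψ a c (Finset.ne_of_mem_erase hx)

variable [Fintype K]

theorem sum_monicFinset_zero (lam : K[X] → ℂ) : ∑ g ∈ monicFinset K 0, lam g = lam 1 := by
  rw [sum_monicFinset]
  simp

theorem sum_kloostermanWeight_two {ψ : AddChar K ℂ} (hψ : ψ ≠ 1) {a c : K} (ha : a ≠ 0)
    (hc : c ≠ 0) :
    ∑ g ∈ monicFinset K 2, kloostermanWeight ψ a c g = Fintype.card K := by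
  have hprim := AddChar.IsPrimitive.of_ne_one hψ
  have hv : ∀ v : Fin 2 → K,
      kloostermanWeight ψ a c (X ^ 2 + ∑ i : Fin 2, monomial (i : ℕ) (v i))
        = if v 0 = 0 then 0 else ψ (v 1 * (-(a + c / v 0))) := by
    intro v
    have h0 := coeff_sum_monomial v 0
    have h1 := coeff_sum_monomial v 1
    have hm : X ^ 2 + ∑ i : Fin 2, monomial (i : ℕ) (v i) ∈ monicFinset K 2 :=
      Finset.mem_image_of_mem _ (Finset.mem_univ v)
    rw [mem_monicFinset] at hm
    rw [kloostermanWeight, nextCoeff_of_natDegree_pos (by omega), hm.2]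
    simp only [Fin.val_zero, Fin.val_one] at h0 h1
    rw [h0, h1]
    congr 2
    ring
  rw [sum_monicFinset, Finset.sum_congr rfl fun v _ => hv v,
    ← (finTwoArrowEquiv K).symm.sum_comp, Fintype.sum_prod_type]
  have hin : ∀ y : K, ∑ z : K, (if ((finTwoArrowEquiv K).symm (y, z)) 0 = 0 then (0 : ℂ) else
      ψ (((finTwoArrowEquiv K).symm (y, z)) 1 * (-(a + c / ((finTwoArrowEquiv K).symm (y, z)) 0))))
      = if y = -c / a then (Fintype.card K : ℂ) else 0 := by
    intro y
    simp only [finTwoArrowEquiv_symm_apply, Matrix.cons_val_zero, Matrix.cons_val_one]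
    by_cases hy : y = 0
    · rw [if_neg]
      · simp [hy]
      · rw [hy]
        exact (div_ne_zero (neg_ne_zero.2 hc) ha).symm
    · simp only [if_neg hy]
      rw [AddChar.sum_mulShift _ hprim]
      have hiff : a + c / y = 0 ↔ y = -c / a := by
        constructor
        · intro h
          field_simp at h ⊢
          linear_combination h
        · rintro rfl
          field_simp
          ring
      simp only [neg_eq_zero, hiff]
      split_ifs <;> simp
  rw [Finset.sum_congr rfl fun y _ => hin y]
  simp

theorem sum_kloostermanWeight_of_three_le {ψ : AddChar K ℂ} (hψ : ψ ≠ 1) {a : K} (c : K)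
    (ha : a ≠ 0) {d : ℕ} (hd : 3 ≤ d) :
    ∑ g ∈ monicFinset K d, kloostermanWeight ψ a c g = 0 := by
  obtain ⟨t, ht⟩ := AddChar.ne_one_iff.1 hψ
  let i0 : Fin d := ⟨0, by omega⟩
  let i1 : Fin d := ⟨1, by omega⟩
  let iu : Fin d := ⟨d - 1, by omega⟩
  have hv : ∀ v : Fin d → K,
      kloostermanWeight ψ a c (X ^ d + ∑ i : Fin d, monomial (i : ℕ) (v i))
        = if v i0 = 0 then 0 else ψ (-(a * v iu + c * (v i1 / v i0))) := by
    intro v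
    have h0 := coeff_sum_monomial v i0
    have h1 := coeff_sum_monomial v i1
    have hu := coeff_sum_monomial v iu
    have hm : X ^ d + ∑ i : Fin d, monomial (i : ℕ) (v i) ∈ monicFinset K d :=
      Finset.mem_image_of_mem _ (Finset.mem_univ v)
    rw [mem_monicFinset] at hm
    rw [kloostermanWeight, nextCoeff_of_natDegree_pos (by omega), hm.2]
    simp only [i0, i1, iu] at h0 h1 hu
    rw [h0, h1, hu]
  rw [sum_monicFinset, Finset.sum_congr rfl fun v _ => hv v]
  set S := ∑ v : Fin d → K, if v i0 = 0 then (0 : ℂ) else ψ (-(a * v iu + c * (v i1 / v i0)))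
    with hS
  have h01 : i0 ≠ iu := by simp [i0, iu, Fin.ext_iff]; omega
  have h11 : i1 ≠ iu := by simp [i1, iu, Fin.ext_iff]; omega
  have hshift : S = ψ t * S := by
    rw [hS, Finset.mul_sum, ← Equiv.sum_comp (Equiv.addRight (Pi.single iu (-t / a) : Fin d → K))]
    refine Finset.sum_congr rfl fun v _ => ?_
    simp only [Equiv.coe_addRight, Pi.add_apply, Pi.single_eq_of_ne h01, Pi.single_eq_of_ne h11,
      Pi.single_eq_same, add_zero]
    split_ifs
    · simp
    · rw [← AddChar.map_add_eq_mul]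
      congr 1
      field_simp
      ring
  have : (ψ t - 1) * S = 0 := by linear_combination -hshift
  exact (mul_eq_zero.1 this).resolve_left (sub_ne_zero.2 ht)

end kloostermanWeight

section powerSums

open Polynomial

theorem norm_le_of_pow_sum_le {ι : Type*} [Fintype ι] (z : ι → ℂ) {B R : ℝ} (hR : 0 < R)
    (h : ∀ᶠ n : ℕ in Filter.atTop, ‖∑ j, z j ^ n‖ ≤ B * R ^ n) (i : ι) : ‖z i‖ ≤ R := by
  set Q : ℂ[X] := ∏ v ∈ (Finset.univ.image z).erase (z i), (X - C v) with hQ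
  have hQ0 : ∀ j, z j ≠ z i → Q.eval (z j) = 0 := by
    intro j hj
    rw [hQ, eval_prod]
    refine Finset.prod_eq_zero (Finset.mem_erase.2 ⟨hj, Finset.mem_image_of_mem z
      (Finset.mem_univ j)⟩) ?_
    simp
  have hQ1 : Q.eval (z i) ≠ 0 := by
    rw [hQ, eval_prod, Finset.prod_ne_zero_iff]
    intro v hv
    rw [eval_sub, eval_X, eval_C, sub_ne_zero]
    exact (Finset.ne_of_mem_erase hv).symm
  set m := (Finset.univ.filter fun j => z j = z i).card with hm
  have hmpos : 1 ≤ m := Finset.card_pos.2 ⟨i, by simp⟩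
  have hkey : ∀ n, (m : ℂ) * (Q.eval (z i) * z i ^ n)
      = ∑ k ∈ Finset.range (Q.natDegree + 1), Q.coeff k * ∑ j, z j ^ (n + k) := by
    intro n
    have h1 : ∀ j, Q.eval (z j) * z j ^ n = if z j = z i then Q.eval (z i) * z i ^ n else 0 := by
      intro j
      split_ifs with hj
      · rw [hj]
      · rw [hQ0 j hj, zero_mul]
    have h2 : ∑ j, Q.eval (z j) * z j ^ n = (m : ℂ) * (Q.eval (z i) * z i ^ n) := by
      rw [Finset.sum_congr rfl fun j _ => h1 j, ← Finset.sum_filter, Finset.sum_const,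
        nsmul_eq_mul]
    rw [← h2]
    simp_rw [Finset.mul_sum, eval_eq_sum_range, Finset.sum_mul]
    rw [Finset.sum_comm]
    refine Finset.sum_congr rfl fun k _ => Finset.sum_congr rfl fun j _ => ?_
    ring
  by_contra! hlt
  set D := ∑ k ∈ Finset.range (Q.natDegree + 1), ‖Q.coeff k‖ * (B * R ^ k) with hD
  have hbound : ∀ᶠ n : ℕ in Filter.atTop, (‖z i‖ / R) ^ n ≤ D / ‖Q.eval (z i)‖ := by
    obtain ⟨N, hN⟩ := Filter.eventually_atTop.1 h
    filter_upwards [Filter.eventually_ge_atTop N] with n hn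
    have h1 : ‖Q.eval (z i)‖ * ‖z i‖ ^ n ≤ D * R ^ n := by
      calc ‖Q.eval (z i)‖ * ‖z i‖ ^ n ≤ m * (‖Q.eval (z i)‖ * ‖z i‖ ^ n) :=
            le_mul_of_one_le_left (by positivity) (by exact_mod_cast hmpos)
        _ = ‖(m : ℂ) * (Q.eval (z i) * z i ^ n)‖ := by simp
        _ ≤ ∑ k ∈ Finset.range (Q.natDegree + 1), ‖Q.coeff k * ∑ j, z j ^ (n + k)‖ := by
            rw [hkey]
            exact norm_sum_le _ _
        _ ≤ ∑ k ∈ Finset.range (Q.natDegree + 1), ‖Q.coeff k‖ * (B * R ^ (n + k)) := by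
            refine Finset.sum_le_sum fun k _ => ?_
            rw [norm_mul]
            exact mul_le_mul_of_nonneg_left (hN _ (by omega)) (norm_nonneg _)
        _ = D * R ^ n := by
            rw [hD, Finset.sum_mul]
            refine Finset.sum_congr rfl fun k _ => ?_
            ring
    have hQpos : 0 < ‖Q.eval (z i)‖ := norm_pos_iff.2 hQ1
    rw [div_pow, div_le_div_iff₀ (pow_pos hR n) hQpos]
    linarith
  have htend := tendsto_pow_atTop_atTop_of_one_lt ((one_lt_div hR).2 hlt)
  obtain ⟨n, hn1, hn2⟩ := (hbound.and (htend.eventually_gt_atTop (D / ‖Q.eval (z i)‖))).exists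
  linarith

end powerSums

section weilBound

theorem exists_frobenius_eigenvalues {p : ℕ} [Fact p.Prime] {ψ : AddChar (ZMod p) ℂ} (hψ : ψ ≠ 1)
    {a c : ZMod p} (ha : a ≠ 0) (hc : c ≠ 0) :
    ∃ α β : ℂ, (∑ x ∈ Finset.univ.erase (0 : ZMod p), ψ (a * x + c * x⁻¹)) = -(α + β) ∧
      ∀ n, 1 ≤ n → ∀ [Fintype (GaloisField p n)],
        ∑ x ∈ Finset.univ.erase (0 : GaloisField p n),
          ψ (a * Algebra.trace (ZMod p) (GaloisField p n) x
            + c * Algebra.trace (ZMod p) (GaloisField p n) x⁻¹) = -(α ^ n + β ^ n) := by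
  let _ : ∀ n, Fintype (GaloisField p n) := fun n => Fintype.ofFinite _
  set lam := kloostermanWeight ψ a c with hlam
  set A : ℕ → ℂ := fun d => ∑ g ∈ monicFinset (ZMod p) d, lam g with hA
  set T : ℕ → ℂ := fun n => ∑ x ∈ Finset.univ.erase (0 : GaloisField p n),
          ψ (a * Algebra.trace (ZMod p) (GaloisField p n) x
            + c * Algebra.trace (ZMod p) (GaloisField p n) x⁻¹) with hT
  have hmul : ∀ g h : Polynomial (ZMod p), g.Monic → h.Monic → lam (g * h) = lam g * lam h :=
    fun g h hg hh => kloostermanWeight_mul ψ a c hg hh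
  have hone : lam 1 = 1 := kloostermanWeight_one ψ a c
  have hrec : ∀ d : ℕ, (d : ℂ) * A d = ∑ n ∈ Finset.Icc 1 d, T n * A (d - n) := by
    intro d
    rw [hA]
    simp only
    rw [natCast_mul_sum_monicFinset hmul hone]
    refine Finset.sum_congr rfl fun n hn => ?_
    rw [Finset.mem_Icc] at hn
    have hfr : Module.finrank (ZMod p) (GaloisField p n) = n := GaloisField.finrank p (by omega)
    have h1 := sum_minpoly_eq (K := ZMod p) (L := GaloisField p n) lam (d := d) (by omega)
    rw [sum_kloostermanWeight_minpoly, hfr] at h1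
    rw [hT]
    simp only
    rw [h1]
  have hA0 : A 0 = 1 := by
    rw [hA]
    simp only
    rw [sum_monicFinset_zero, hone]
  have hA2 : A 2 = p := by
    rw [hA]
    simp only
    rw [sum_kloostermanWeight_two hψ ha hc, ZMod.card]
  have hA3 : ∀ d, A (d + 3) = 0 := fun d =>
    sum_kloostermanWeight_of_three_le hψ c ha (by omega)
  have hA1 : A 1 = ∑ x ∈ Finset.univ.erase (0 : ZMod p), ψ (a * x + c * x⁻¹) := by
    have h1 := natCast_mul_sum_monicFinset hmul hone 1
    have h2 := sum_minpoly_eq (K := ZMod p) (L := ZMod p) lam (d := 1) (by simp)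
    rw [sum_kloostermanWeight_minpoly] at h2
    simp only [Module.finrank_self, Algebra.trace_self_apply] at h2
    rw [Finset.Icc_self, Finset.sum_singleton] at h1
    rw [Nat.cast_one, one_mul, Nat.sub_self, sum_monicFinset_zero, hone, mul_one] at h1
    rw [Finset.Icc_self, ← h1] at h2
    rw [hA]
    simp only
    rw [← h2]
    congr!
  obtain ⟨s, hs⟩ := IsAlgClosed.exists_pow_nat_eq (A 1 ^ 2 - 4 * p) (n := 2) (by norm_num)
  refine ⟨(-A 1 + s) / 2, (-A 1 - s) / 2, ?_, ?_⟩
  · rw [← hA1]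
    ring
  set α := (-A 1 + s) / 2 with hα
  set β := (-A 1 - s) / 2 with hβ
  have hsum : α + β = -A 1 := by rw [hα, hβ]; ring
  have hprod : α * β = p := by rw [hα, hβ]; linear_combination -hs / 4
  have hαr : α ^ 2 = -A 1 * α - p := by linear_combination α * hsum - hprod
  have hβr : β ^ 2 = -A 1 * β - p := by linear_combination β * hsum - hprod
  have hT1 : T 1 = A 1 := by
    have := hrec 1
    simp [hA0] at this
    exact this.symm
  have hT2 : T 2 = 2 * p - A 1 * T 1 := by
    have := hrec 2
    rw [Finset.sum_Icc_succ_top (by norm_num), Finset.Icc_self, Finset.sum_singleton] at this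
    simp [hA0, hA2] at this
    linear_combination -this
  have hT3 : ∀ d, T (d + 3) = -A 1 * T (d + 2) - p * T (d + 1) := by
    intro d
    have := hrec (d + 3)
    rw [hA3, mul_zero, Finset.sum_Icc_succ_top (by omega), Finset.sum_Icc_succ_top (by omega),
      Finset.sum_Icc_succ_top (by omega), Finset.sum_eq_zero] at this
    · simp only [show d + 3 - (d + 1) = 2 by omega, show d + 3 - (d + 2) = 1 by omega,
        show d + 3 - (d + 2 + 1) = 0 by omega, hA0, hA2] at this
      linear_combination -this
    · intro n hn
      rw [Finset.mem_Icc] at hn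
      rw [show d + 3 - n = (d - n) + 3 by omega, hA3, mul_zero]
  have hfin : ∀ n, T (n + 1) = -(α ^ (n + 1) + β ^ (n + 1)) ∧
      T (n + 2) = -(α ^ (n + 2) + β ^ (n + 2)) := by
    intro n
    induction n with
    | zero =>
      refine ⟨?_, ?_⟩
      · rw [zero_add, hT1]
        linear_combination -hsum
      · rw [zero_add, hT2, hT1]
        linear_combination hαr + hβr - A 1 * hsum
    | succ n ih =>
      refine ⟨ih.2, ?_⟩
      rw [show n + 1 + 2 = n + 3 by ring, hT3, ih.1, ih.2]
      linear_combination α ^ (n + 1) * hαr + β ^ (n + 1) * hβr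
  intro n hn _
  obtain ⟨m, rfl⟩ := Nat.exists_eq_add_of_le' hn
  rw [← (hfin m).1, hT]
  simp only
  congr!

theorem norm_kloosterman_le_of_ne_two {p : ℕ} [Fact p.Prime] (hp : p ≠ 2) {ψ : AddChar (ZMod p) ℂ}
    (hψ : ψ ≠ 1) {a c : ZMod p} (ha : a ≠ 0) (hc : c ≠ 0) :
    ‖∑ x ∈ Finset.univ.erase (0 : ZMod p), ψ (a * x + c * x⁻¹)‖ ≤ 2 * √p := by
  have hp1 : 1 < p := (Fact.out : p.Prime).one_lt
  let _ : ∀ n, Fintype (GaloisField p n) := fun n => Fintype.ofFinite _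
  set b := c / a with hb
  have hb0 : b ≠ 0 := div_ne_zero hc ha
  have hex := fun t : (ZMod p)ˣ => exists_frobenius_eigenvalues hψ t.ne_zero
    (mul_ne_zero t.ne_zero hb0)
  choose α β h1 h2 using hex
  have hz := norm_le_of_pow_sum_le
    (fun t : (ZMod p)ˣ ⊕ (ZMod p)ˣ => Sum.elim (fun t => α t ^ 2) (fun t => β t ^ 2) t)
    (B := 12 * p + 10) (R := p) (by positivity) (by
      have htend := tendsto_pow_atTop_atTop_of_one_lt hp1
      filter_upwards [htend.eventually_ge_atTop (8 * p + 11), Filter.eventually_ge_atTop 1]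
        with n hn hn1
      have hF : Fintype.card (GaloisField p (2 * n)) = (p ^ n) ^ 2 := by
        rw [← Nat.card_eq_fintype_card, GaloisField.card p _ (by omega)]
        ring
      have hmain := norm_sum_addChar_trace_le hp rfl hF hn hb0 hψ
      have hsum : ∑ t : ZMod p with t ≠ 0, ∑ x ∈ Finset.univ.erase (0 : GaloisField p (2 * n)),
          ψ (t * Algebra.trace (ZMod p) _ x + (t * b) * Algebra.trace (ZMod p) _ x⁻¹)
          = -∑ t : (ZMod p)ˣ ⊕ (ZMod p)ˣ,
            (Sum.elim (fun t => α t ^ 2) (fun t => β t ^ 2) t) ^ n := by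
        rw [Fintype.sum_sum_type]
        simp only [Sum.elim_inl, Sum.elim_inr]
        rw [← Finset.sum_add_distrib, ← Finset.sum_neg_distrib]
        symm
        refine Finset.sum_bij (fun t _ => (t : ZMod p)) ?_ ?_ ?_ ?_
        · intro t _
          simp
        · intro t _ s _ h
          exact Units.ext h
        · intro t ht
          exact ⟨Units.mk0 t (Finset.mem_filter.1 ht).2, Finset.mem_univ _, rfl⟩
        · intro t _
          rw [h2 t (2 * n) (by omega), pow_mul, pow_mul]
      rw [← Finset.filter_ne', hsum, norm_neg] at hmain
      exact_mod_cast hmain)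
  have hle : ∀ w : ℂ, ‖w ^ 2‖ ≤ p → ‖w‖ ≤ √p := by
    intro w hw
    rw [norm_pow] at hw
    exact Real.le_sqrt_of_sq_le hw
  have ha1 := hle _ (hz (Sum.inl (Units.mk0 a ha)))
  have ha2 := hle _ (hz (Sum.inr (Units.mk0 a ha)))
  have h3 := h1 (Units.mk0 a ha)
  rw [Units.val_mk0, hb, mul_div_cancel₀ _ ha] at h3
  rw [h3, norm_neg]
  calc _ ≤ _ := norm_add_le _ _
    _ ≤ _ := by linarith

theorem norm_kloosterman_prime_le {p : ℕ} [Fact p.Prime] {ψ : AddChar (ZMod p) ℂ}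
    (hψ : ψ ≠ 1) {a c : ZMod p} (ha : a ≠ 0) (hc : c ≠ 0) :
    ‖∑ x ∈ Finset.univ.erase (0 : ZMod p), ψ (a * x + c * x⁻¹)‖ ≤ 2 * √p := by
  by_cases hp : p = 2
  · subst hp
    calc _ ≤ ∑ x ∈ Finset.univ.erase (0 : ZMod 2), ‖ψ (a * x + c * x⁻¹)‖ := norm_sum_le _ _
      _ = 1 := by
        simp
      _ ≤ 2 * √(2 : ℕ) := by
        have : 1 ≤ √((2 : ℕ) : ℝ) := Real.one_le_sqrt.2 (by norm_num)
        linarith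
  · exact norm_kloosterman_le_of_ne_two hp hψ ha hc

end weilBound

/-- The Kloosterman sum modulo `q` attached to an additive character. -/
noncomputable def kloostermanSum {q : ℕ} [NeZero q] (ψ : AddChar (ZMod q) ℂ) (m n : ZMod q) : ℂ :=
  ∑ u : (ZMod q)ˣ, ψ (m * u + n * (u⁻¹ : (ZMod q)ˣ))

section primePower

theorem kloostermanSum_eq_mul_unit {q : ℕ} [NeZero q] (ψ : AddChar (ZMod q) ℂ) (m n : ZMod q)
    (w : (ZMod q)ˣ) :
    kloostermanSum ψ m n = kloostermanSum ψ (m * w) (n * (w⁻¹ : (ZMod q)ˣ)) := by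
  unfold kloostermanSum
  rw [← Equiv.sum_comp (Equiv.mulLeft w)]
  refine Finset.sum_congr rfl fun u _ => ?_
  simp only [Equiv.coe_mulLeft, Units.val_mul, mul_inv]
  congr 1
  ring

theorem norm_kloostermanSum_le_card {q : ℕ} [NeZero q] {ψ : AddChar (ZMod q) ℂ}
    (hψ : ψ.IsPrimitive) (m n d : ZMod q) (hd : IsNilpotent d) (hn : n * d ^ 2 = 0) :
    ‖kloostermanSum ψ m n‖
      ≤ (Finset.univ.filter fun u : (ZMod q)ˣ => d * (m * u ^ 2 - n) = 0).card := by
  have hunit : ∀ t : ZMod q, IsUnit (1 + d * t) := fun t =>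
    ((Commute.all d t).isNilpotent_mul_right hd).isUnit_one_add
  have hshift : ∀ t : ZMod q, kloostermanSum ψ m n = ∑ u : (ZMod q)ˣ,
      ψ (m * u + n * (u⁻¹ : (ZMod q)ˣ)) * ψ (t * (d * (m * u - n * (u⁻¹ : (ZMod q)ˣ)))) := by
    intro t
    obtain ⟨w, hw⟩ := hunit t
    have hwi : n * (w⁻¹ : (ZMod q)ˣ) = n * (1 - d * t) := by
      have h1 : n = n * (1 - d * t) * w := by
        rw [hw]
        linear_combination t ^ 2 * hn
      conv_lhs => rw [h1, mul_assoc, Units.mul_inv, mul_one]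
    rw [kloostermanSum_eq_mul_unit ψ m n w, hwi, hw, kloostermanSum]
    refine Finset.sum_congr rfl fun u _ => ?_
    rw [← AddChar.map_add_eq_mul]
    congr 1
    ring
  have hq : (q : ℂ) ≠ 0 := by exact_mod_cast NeZero.ne q
  have hsum : (q : ℂ) * kloostermanSum ψ m n = q * ∑ u ∈ Finset.univ.filter
      (fun u : (ZMod q)ˣ => d * (m * u ^ 2 - n) = 0), ψ (m * u + n * (u⁻¹ : (ZMod q)ˣ)) := by
    have h1 : (q : ℂ) * kloostermanSum ψ m n = ∑ _t : ZMod q, kloostermanSum ψ m n := by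
      rw [Finset.sum_const, Finset.card_univ, ZMod.card, nsmul_eq_mul]
    rw [h1, Finset.sum_congr rfl fun t _ => hshift t, Finset.sum_comm, Finset.mul_sum,
      Finset.sum_filter]
    refine Finset.sum_congr rfl fun u _ => ?_
    rw [← Finset.mul_sum, AddChar.sum_mulShift _ hψ, ZMod.card]
    have hiff : d * (m * u - n * (u⁻¹ : (ZMod q)ˣ)) = 0 ↔ d * (m * u ^ 2 - n) = 0 := by
      rw [← Units.mul_left_eq_zero u]
      have : d * (m * u - n * (u⁻¹ : (ZMod q)ˣ)) * u = d * (m * u ^ 2 - n) := by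
        linear_combination -d * n * u.inv_mul
      rw [this]
    simp only [hiff]
    split_ifs <;> push_cast <;> ring
  rw [mul_left_cancel₀ hq hsum]
  refine (norm_sum_le _ _).trans ?_
  simp

theorem pow_dvd_two_mul_of_dvd_mul {p : ℕ} (hp : p.Prime) {l : ℕ} {x y u : ℤ}
    (hu : ¬ (p : ℤ) ∣ u) (hxy : x + y = 2 * u) (h : (p : ℤ) ^ l ∣ x * y) :
    (p : ℤ) ^ l ∣ 2 * x ∨ (p : ℤ) ^ l ∣ 2 * y := by
  have hpi : Prime (p : ℤ) := Nat.prime_iff_prime_int.1 hp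
  have hcop : ∀ z w : ℤ, ¬ (p : ℤ) ∣ z → (p : ℤ) ^ l ∣ z * w → (p : ℤ) ^ l ∣ w := by
    intro z w hz hzw
    exact IsCoprime.dvd_of_dvd_mul_left
      (((hpi.coprime_iff_not_dvd).2 hz).pow_left) hzw
  by_cases hx : (p : ℤ) ∣ x
  · by_cases hy : (p : ℤ) ∣ y
    · have h2u : (p : ℤ) ∣ 2 * u := hxy ▸ dvd_add hx hy
      have h2 : (p : ℤ) ∣ 2 := (hpi.dvd_or_dvd h2u).resolve_right hu
      have hp2 : p = 2 := by
        have : p ∣ 2 := by exact_mod_cast h2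
        exact (Nat.prime_dvd_prime_iff_eq hp Nat.prime_two).1 this
      subst hp2
      obtain ⟨x', rfl⟩ := hx
      obtain ⟨y', rfl⟩ := hy
      push_cast at *
      by_cases hx' : (2 : ℤ) ∣ x'
      · left
        have hy' : ¬ (2 : ℤ) ∣ y' := by omega
        refine hcop y' _ hy' (h.trans (dvd_of_eq (by ring)))
      · right
        exact hcop x' _ hx' (h.trans (dvd_of_eq (by ring)))
    · left
      exact (hcop y x hy (by rwa [mul_comm])).mul_left 2
  · right
    exact (hcop x y hx h).mul_left 2

theorem card_quadratic_solutions_le {p k s q : ℕ} [NeZero q] (hp : p.Prime) (hq : q = p ^ k)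
    (m n : ℕ) :
    (Finset.univ.filter fun u : (ZMod q)ˣ => ((p ^ s : ℕ) : ZMod q) * (m * u ^ 2 - n) = 0).card
      ≤ 4 * p ^ s * Nat.gcd (Nat.gcd m n) q := by
  subst hq
  obtain ⟨j, hjk, hj⟩ := (Nat.dvd_prime_pow hp).1 (Nat.gcd_dvd_right (Nat.gcd m n) (p ^ k))
  rw [hj]
  by_cases hjs : k ≤ s + j
  · calc _ ≤ Fintype.card (ZMod (p ^ k))ˣ := Finset.card_le_univ _
      _ ≤ p ^ k := by rw [ZMod.card_units_eq_totient]; exact Nat.totient_le _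
      _ ≤ p ^ (s + j) := Nat.pow_le_pow_right hp.pos hjs
      _ ≤ _ := by rw [pow_add]; nlinarith [Nat.zero_le (p ^ s * p ^ j)]
  push Not at hjs
  obtain ⟨m', hm'⟩ : p ^ j ∣ m := hj ▸ (Nat.gcd_dvd_left _ _).trans (Nat.gcd_dvd_left _ _)
  obtain ⟨n', hn'⟩ : p ^ j ∣ n := hj ▸ (Nat.gcd_dvd_left _ _).trans (Nat.gcd_dvd_right _ _)
  have hndvd : ¬ (p ∣ m' ∧ p ∣ n') := by
    rintro ⟨⟨a, rfl⟩, ⟨b, rfl⟩⟩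
    have h1 : p ^ (j + 1) ∣ Nat.gcd (Nat.gcd m n) (p ^ k) := by
      refine Nat.dvd_gcd (Nat.dvd_gcd ⟨a, ?_⟩ ⟨b, ?_⟩) (Nat.pow_dvd_pow _ (by omega))
      · rw [hm']; ring
      · rw [hn']; ring
    rw [hj] at h1
    have := (Nat.pow_dvd_pow_iff_le_right hp.one_lt).1 h1
    omega
  set l := k - s - j with hl
  have hpi : Prime (p : ℤ) := Nat.prime_iff_prime_int.1 hp
  have hp0 : (p : ℤ) ≠ 0 := by exact_mod_cast hp.ne_zero
  have hcond : ∀ u : (ZMod (p ^ k))ˣ, ((p ^ s : ℕ) : ZMod (p ^ k)) * (m * u ^ 2 - n) = 0 →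
      (p : ℤ) ^ l ∣ m' * ((u : ZMod (p ^ k)).val : ℤ) ^ 2 - n' := by
    intro u hu
    have h1 : (((p ^ s * (m * ((u : ZMod (p ^ k)).val : ℤ) ^ 2 - n) : ℤ)) : ZMod (p ^ k)) = 0 := by
      push_cast
      rw [ZMod.natCast_zmod_val]
      exact_mod_cast hu
    rw [ZMod.intCast_zmod_eq_zero_iff_dvd] at h1
    have h2 : ((p ^ k : ℕ) : ℤ) = p ^ (s + j) * p ^ l := by
      rw [← pow_add]
      push_cast
      congr 1
      omega
    have h3 : (p ^ s * (m * ((u : ZMod (p ^ k)).val : ℤ) ^ 2 - n) : ℤ)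
        = p ^ (s + j) * (m' * ((u : ZMod (p ^ k)).val : ℤ) ^ 2 - n') := by
      rw [hm', hn']
      push_cast
      ring
    rw [h2, h3] at h1
    exact (mul_dvd_mul_iff_left (pow_ne_zero _ hp0)).1 h1
  have hlpos : 1 ≤ l := by omega
  have hk0 : k ≠ 0 := by omega
  have hval : ∀ u : (ZMod (p ^ k))ˣ, ¬ (p : ℤ) ∣ ((u : ZMod (p ^ k)).val : ℤ) := by
    intro u h
    have h1 := ZMod.val_coe_unit_coprime u
    rw [Nat.coprime_pow_right_iff (by omega)] at h1
    have h2 : p ∣ (u : ZMod (p ^ k)).val := by exact_mod_cast h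
    exact hp.one_lt.ne' (Nat.dvd_one.1 (h1 ▸ Nat.dvd_gcd h2 dvd_rfl))
  set N := 2 * p ^ (s + j) with hN
  have hNpos : 0 < N := Nat.mul_pos two_pos (Nat.pow_pos hp.pos)
  have hcount : ∀ w : ZMod (p ^ k),
      (Finset.univ.filter fun u : (ZMod (p ^ k))ˣ => N • ((u : ZMod (p ^ k)) + w) = 0).card ≤ N := by
    intro w
    refine le_trans (Finset.card_le_card_of_injOn (fun u : (ZMod (p ^ k))ˣ => (u : ZMod (p ^ k)) + w)
      ?_ ?_) (IsAddCyclic.card_nsmul_eq_zero_le (α := ZMod (p ^ k)) hNpos)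
    · intro u hu
      exact Finset.mem_coe.2 (Finset.mem_filter.2 ⟨Finset.mem_univ _, (Finset.mem_filter.1 hu).2⟩)
    · intro u _ v _ h
      exact Units.ext (add_right_cancel h)
  have hzero : ∀ z : ℤ, (p : ℤ) ^ l ∣ 2 * z → N • (z : ZMod (p ^ k)) = 0 := by
    intro z hz
    have h1 : N • (z : ZMod (p ^ k)) = ((N * z : ℤ) : ZMod (p ^ k)) := by
      rw [nsmul_eq_mul]
      push_cast
      ring
    rw [h1, ZMod.intCast_zmod_eq_zero_iff_dvd]
    have h2 : ((p ^ k : ℕ) : ℤ) = p ^ (s + j) * p ^ l := by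
      rw [← pow_add]
      push_cast
      congr 1
      omega
    rw [h2, hN]
    push_cast
    rw [show (2 * (p : ℤ) ^ (s + j) * z) = p ^ (s + j) * (2 * z) by ring]
    exact mul_dvd_mul_left _ hz
  set F := Finset.univ.filter fun u : (ZMod (p ^ k))ˣ =>
      ((p ^ s : ℕ) : ZMod (p ^ k)) * (m * u ^ 2 - n) = 0 with hF
  rcases F.eq_empty_or_nonempty with hFe | ⟨v, hv⟩
  · rw [hFe]
    simp
  have hm'p : ¬ (p : ℤ) ∣ m' := by
    intro hdvd
    have h1 := (dvd_pow_self (p : ℤ) (by omega : l ≠ 0)).trans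
      (hcond v (Finset.mem_filter.1 hv).2)
    have h2 : (p : ℤ) ∣ n' := by
      have := dvd_sub (hdvd.mul_right (((v : ZMod (p ^ k)).val : ℤ) ^ 2)) h1
      simpa using this
    exact hndvd ⟨by exact_mod_cast hdvd, by exact_mod_cast h2⟩
  have hsub : F ⊆ (Finset.univ.filter fun u : (ZMod (p ^ k))ˣ =>
        N • ((u : ZMod (p ^ k)) + -v) = 0) ∪
      (Finset.univ.filter fun u : (ZMod (p ^ k))ˣ => N • ((u : ZMod (p ^ k)) + v) = 0) := by
    intro u hu
    have h1 := dvd_sub (hcond u (Finset.mem_filter.1 hu).2) (hcond v (Finset.mem_filter.1 hv).2)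
    have h2 : (p : ℤ) ^ l ∣ (((u : ZMod (p ^ k)).val : ℤ) - ((v : ZMod (p ^ k)).val : ℤ)) *
        (((u : ZMod (p ^ k)).val : ℤ) + ((v : ZMod (p ^ k)).val : ℤ)) := by
      refine IsCoprime.dvd_of_dvd_mul_left (((hpi.coprime_iff_not_dvd).2 hm'p).pow_left)
        (h1.trans (dvd_of_eq ?_))
      ring
    rw [Finset.mem_union, Finset.mem_filter, Finset.mem_filter]
    refine (pow_dvd_two_mul_of_dvd_mul hp (hval u) (by ring) h2).imp ?_ ?_
    · intro h3
      have := hzero _ h3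
      push_cast [ZMod.natCast_zmod_val] at this
      exact ⟨Finset.mem_univ _, by rwa [← sub_eq_add_neg]⟩
    · intro h3
      have := hzero _ h3
      push_cast [ZMod.natCast_zmod_val] at this
      exact ⟨Finset.mem_univ _, this⟩
  calc F.card ≤ _ := Finset.card_le_card hsub
    _ ≤ _ := Finset.card_union_le _ _
    _ ≤ N + N := Nat.add_le_add (hcount _) (hcount _)
    _ = 4 * p ^ s * p ^ j := by rw [hN, pow_add]; ring

end primePower

section quadraticGauss

/-- A quadratic Gauss sum `∑ t, ψ (A t + C t²)` whose quadratic part degenerates exactly on the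
`N`-torsion. -/
theorem norm_sq_sum_quadratic_le {q : ℕ} [NeZero q] {ψ : AddChar (ZMod q) ℂ}
    (hψ : ψ.IsPrimitive) (A C : ZMod q) {N : ℕ} (hN : 0 < N)
    (hC : ∀ h : ZMod q, 2 * C * h = 0 → N • h = 0)
    (hC2 : ∀ h : ZMod q, 2 * C * h = 0 → C * h ^ 2 = 0) :
    ‖∑ t : ZMod q, ψ (A * t + C * t ^ 2)‖ ^ 2 ≤
      if ∀ h, 2 * C * h = 0 → ψ (A * h) = 1 then (q * N : ℝ) else 0 := by
  have h1 : ((‖∑ t : ZMod q, ψ (A * t + C * t ^ 2)‖ ^ 2 : ℝ) : ℂ)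
      = q * ∑ h ∈ Finset.univ.filter (fun h : ZMod q => 2 * C * h = 0), ψ (A * h) := by
    push_cast
    rw [← Complex.conj_mul', map_sum, Finset.sum_mul_sum]
    have h2 : ∀ t : ZMod q, ∑ s : ZMod q,
        (starRingEnd ℂ) (ψ (A * t + C * t ^ 2)) * ψ (A * s + C * s ^ 2)
        = ∑ h : ZMod q, ψ (A * h + C * h ^ 2) * ψ (t * (2 * C * h)) := by
      intro t
      rw [← Equiv.sum_comp (Equiv.addLeft t)]
      refine Finset.sum_congr rfl fun h _ => ?_
      rw [← AddChar.map_neg_eq_conj, ← AddChar.map_add_eq_mul, ← AddChar.map_add_eq_mul,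
        Equiv.coe_addLeft]
      congr 1
      ring
    rw [Finset.sum_congr rfl fun t _ => h2 t, Finset.sum_comm, Finset.mul_sum, Finset.sum_filter]
    refine Finset.sum_congr rfl fun h _ => ?_
    rw [← Finset.mul_sum, AddChar.sum_mulShift _ hψ, ZMod.card]
    split_ifs with hh
    · rw [hC2 h hh, add_zero]
      ring
    · simp
  split_ifs with hA
  · have h2 : ∑ h ∈ Finset.univ.filter (fun h : ZMod q => 2 * C * h = 0), ψ (A * h)
        = ((Finset.univ.filter (fun h : ZMod q => 2 * C * h = 0)).card : ℂ) := by
      rw [Finset.sum_congr rfl fun h hh => hA h (Finset.mem_filter.1 hh).2]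
      simp
    rw [h2] at h1
    have h3 : ‖∑ t : ZMod q, ψ (A * t + C * t ^ 2)‖ ^ 2
        = q * ((Finset.univ.filter (fun h : ZMod q => 2 * C * h = 0)).card : ℝ) := by
      exact_mod_cast h1
    rw [h3]
    have h4 : (Finset.univ.filter (fun h : ZMod q => 2 * C * h = 0)).card ≤ N := by
      refine le_trans (Finset.card_le_card ?_) (IsAddCyclic.card_nsmul_eq_zero_le (α := ZMod q) hN)
      intro h hh
      rw [Finset.mem_filter] at hh ⊢
      exact ⟨Finset.mem_univ _, hC h hh.2⟩
    exact mul_le_mul_of_nonneg_left (by exact_mod_cast h4) (Nat.cast_nonneg _)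
  · push Not at hA
    obtain ⟨h0, hh0, hne⟩ := hA
    set S := ∑ h ∈ Finset.univ.filter (fun h : ZMod q => 2 * C * h = 0), ψ (A * h) with hS
    have h2 : S = ψ (A * h0) * S := by
      rw [hS, Finset.mul_sum]
      refine Finset.sum_bij (fun h _ => h - h0) ?_ ?_ ?_ ?_
      · intro h hh
        rw [Finset.mem_filter] at hh ⊢
        exact ⟨Finset.mem_univ _, by rw [mul_sub, hh.2, hh0, sub_zero]⟩
      · intro h _ h' _ hh
        exact sub_left_injective hh
      · intro h hh
        rw [Finset.mem_filter] at hh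
        exact ⟨h + h0, Finset.mem_filter.2 ⟨Finset.mem_univ _, by
          rw [mul_add, hh.2, hh0, add_zero]⟩, add_sub_cancel_right _ _⟩
      · intro h _
        rw [← AddChar.map_add_eq_mul]
        congr 1
        ring
    have h3 : (ψ (A * h0) - 1) * S = 0 := by linear_combination -h2
    rw [(mul_eq_zero.1 h3).resolve_left (sub_ne_zero.2 hne), mul_zero] at h1
    exact le_of_eq (by exact_mod_cast h1)

theorem norm_kloostermanSum_odd_exponent_le {p l q : ℕ} [NeZero q] (hp : p.Prime) (hp2 : p ≠ 2)
    (hl : 1 ≤ l) (hq : q = p ^ (2 * l + 1)) {ψ : AddChar (ZMod q) ℂ} (hψ : ψ.IsPrimitive)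
    (m n : ℕ) (hn : ¬ p ∣ n) :
    ‖kloostermanSum ψ m n‖ ≤ 4 * √(q : ℝ) := by
  set d : ZMod q := ((p ^ l : ℕ) : ZMod q) with hd
  have hpq : ∀ e, 2 * l + 1 ≤ e → (p : ZMod q) ^ e = 0 := by
    intro e he
    have : ((p ^ e : ℕ) : ZMod q) = 0 :=
      (ZMod.natCast_eq_zero_iff _ _).2 (hq ▸ Nat.pow_dvd_pow p he)
    exact_mod_cast this
  have hd3 : d ^ 3 = 0 := by
    rw [hd, Nat.cast_pow, ← pow_mul]
    exact hpq _ (by omega)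
  have hnil : IsNilpotent d := ⟨3, hd3⟩
  have hunit : ∀ t : ZMod q, IsUnit (1 + d * t) := fun t =>
    ((Commute.all d t).isNilpotent_mul_right hnil).isUnit_one_add
  have hcopn : ∀ z : ℕ, ¬ p ∣ z → IsUnit (z : ZMod q) := by
    intro z hz
    rw [ZMod.isUnit_iff_coprime]
    rw [hq]
    exact ((Nat.Prime.coprime_iff_not_dvd hp).2 hz).symm.pow_right _
  have hnu : IsUnit (n : ZMod q) := hcopn n hn
  have h2u : IsUnit (2 : ZMod q) := by
    simpa using hcopn 2 fun h => hp2 ((Nat.prime_dvd_prime_iff_eq hp Nat.prime_two).1 h)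
  have hshift : ∀ t : ZMod q, kloostermanSum ψ m n = ∑ u : (ZMod q)ˣ,
      ψ (m * u + n * (u⁻¹ : (ZMod q)ˣ)) *
        ψ (d * (m * u - n * (u⁻¹ : (ZMod q)ˣ)) * t + d ^ 2 * (n * (u⁻¹ : (ZMod q)ˣ)) * t ^ 2) := by
    intro t
    obtain ⟨w, hw⟩ := hunit t
    have hwi : ((w⁻¹ : (ZMod q)ˣ) : ZMod q) = 1 - d * t + d ^ 2 * t ^ 2 := by
      rw [← Units.mul_eq_one_iff_inv_eq, hw]
      linear_combination t ^ 3 * hd3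
    rw [kloostermanSum_eq_mul_unit ψ m n w, hwi, hw, kloostermanSum]
    refine Finset.sum_congr rfl fun u _ => ?_
    rw [← AddChar.map_add_eq_mul]
    congr 1
    ring
  have hsum : (q : ℂ) * kloostermanSum ψ m n = ∑ u : (ZMod q)ˣ,
      ψ (m * u + n * (u⁻¹ : (ZMod q)ˣ)) * ∑ t : ZMod q,
        ψ (d * (m * u - n * (u⁻¹ : (ZMod q)ˣ)) * t + d ^ 2 * (n * (u⁻¹ : (ZMod q)ˣ)) * t ^ 2) := by
    have h1 : (q : ℂ) * kloostermanSum ψ m n = ∑ _t : ZMod q, kloostermanSum ψ m n := by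
      rw [Finset.sum_const, Finset.card_univ, ZMod.card, nsmul_eq_mul]
    rw [h1, Finset.sum_congr rfl fun t _ => hshift t, Finset.sum_comm]
    exact Finset.sum_congr rfl fun u _ => (Finset.mul_sum _ _ _).symm
  set d' : ZMod q := ((p ^ (l + 1) : ℕ) : ZMod q) with hd'
  have hdd' : d' = d * p := by rw [hd, hd']; push_cast; ring
  have hG : ∀ u : (ZMod q)ˣ, ‖∑ t : ZMod q,
        ψ (d * (m * u - n * (u⁻¹ : (ZMod q)ˣ)) * t + d ^ 2 * (n * (u⁻¹ : (ZMod q)ˣ)) * t ^ 2)‖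
      ≤ if d' * (m * u ^ 2 - n) = 0 then √(q : ℝ) * p ^ l else 0 := by
    intro u
    set C : ZMod q := d ^ 2 * (n * (u⁻¹ : (ZMod q)ˣ)) with hC
    have htors : ∀ h : ZMod q, 2 * C * h = 0 ↔ d ^ 2 * h = 0 := by
      intro h
      have hu : IsUnit (2 * (n * ((u⁻¹ : (ZMod q)ˣ) : ZMod q))) := h2u.mul (hnu.mul (Units.isUnit _))
      rw [show 2 * C * h = 2 * (n * ((u⁻¹ : (ZMod q)ˣ) : ZMod q)) * (d ^ 2 * h) by rw [hC]; ring]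
      exact hu.mul_right_eq_zero
    have hmain := norm_sq_sum_quadratic_le hψ (d * (m * u - n * (u⁻¹ : (ZMod q)ˣ))) C
      (N := p ^ (2 * l)) (Nat.pow_pos hp.pos)
      (by
        intro h hh
        rw [htors] at hh
        rw [nsmul_eq_mul, ← hh, hd]
        push_cast
        ring)
      (by
        intro h hh
        rw [htors] at hh
        rw [hC]
        linear_combination n * (u⁻¹ : (ZMod q)ˣ) * h * hh)
    have hif : (∀ h, 2 * C * h = 0 → ψ (d * (m * u - n * (u⁻¹ : (ZMod q)ˣ)) * h) = 1) →
        d' * (m * u ^ 2 - n) = 0 := by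
      intro hall
      by_contra hne
      have hne' : d' * (m * u - n * (u⁻¹ : (ZMod q)ˣ)) ≠ 0 := by
        intro h0
        apply hne
        linear_combination u * h0 + d' * n * u.inv_mul
      obtain ⟨x, hx⟩ := AddChar.ne_one_iff.1 (hψ hne')
      apply hx
      rw [AddChar.mulShift_apply]
      have := hall (p * x) (by
        rw [htors, hd]
        push_cast
        linear_combination x * hpq (2 * l + 1) le_rfl)
      rw [← this, hdd']
      congr 1
      ring
    split_ifs with h0
    · refine le_of_sq_le_sq ?_ (by positivity)
      refine hmain.trans ?_
      have hpos : (0 : ℝ) ≤ q * (p ^ (2 * l) : ℕ) := by positivity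
      rw [mul_pow, Real.sq_sqrt (Nat.cast_nonneg _)]
      split_ifs
      · apply le_of_eq
        push_cast
        ring
      · positivity
    · rw [if_neg fun h => h0 (hif h)] at hmain
      nlinarith [norm_nonneg (∑ t : ZMod q,
        ψ (d * (m * u - n * (u⁻¹ : (ZMod q)ˣ)) * t + C * t ^ 2))]
  have hgcd : Nat.gcd (Nat.gcd m n) q = 1 := by
    rw [hq]
    apply Nat.Coprime.pow_right
    exact (((Nat.Prime.coprime_iff_not_dvd hp).2 hn).symm.coprime_dvd_left (Nat.gcd_dvd_right m n))
  have hcount := card_quadratic_solutions_le (s := l + 1) hp hq m n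
  rw [hgcd, mul_one] at hcount
  have hqpos : (0 : ℝ) < q := by exact_mod_cast NeZero.pos q
  have hfin : (q : ℝ) * ‖kloostermanSum ψ m n‖ ≤ q * (4 * √(q : ℝ)) := by
    calc (q : ℝ) * ‖kloostermanSum ψ m n‖ = ‖(q : ℂ) * kloostermanSum ψ m n‖ := by simp
      _ ≤ ∑ u : (ZMod q)ˣ, ‖ψ (m * u + n * (u⁻¹ : (ZMod q)ˣ)) * ∑ t : ZMod q,
        ψ (d * (m * u - n * (u⁻¹ : (ZMod q)ˣ)) * t + d ^ 2 * (n * (u⁻¹ : (ZMod q)ˣ)) * t ^ 2)‖ := by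
          rw [hsum]
          exact norm_sum_le _ _
      _ ≤ ∑ u : (ZMod q)ˣ, if d' * (m * u ^ 2 - n) = 0 then √(q : ℝ) * p ^ l else 0 := by
          refine Finset.sum_le_sum fun u _ => ?_
          rw [norm_mul, AddChar.norm_apply, one_mul]
          exact hG u
      _ = (Finset.univ.filter fun u : (ZMod q)ˣ => d' * (m * u ^ 2 - n) = 0).card
            * (√(q : ℝ) * p ^ l) := by
          rw [← Finset.sum_filter, Finset.sum_const, nsmul_eq_mul]
      _ ≤ ((4 * p ^ (l + 1) : ℕ) : ℝ) * (√(q : ℝ) * p ^ l) := by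
          refine mul_le_mul_of_nonneg_right ?_ (by positivity)
          exact_mod_cast hcount
      _ = q * (4 * √(q : ℝ)) := by
          rw [show (q : ℝ) = p ^ (2 * l + 1) by rw [hq]; push_cast; rfl]
          push_cast
          ring
  exact le_of_mul_le_mul_left hfin hqpos

end quadraticGauss

section primePowerBound

theorem kloostermanSum_comm {q : ℕ} [NeZero q] (ψ : AddChar (ZMod q) ℂ) (m n : ZMod q) :
    kloostermanSum ψ m n = kloostermanSum ψ n m := by
  unfold kloostermanSum
  rw [← Equiv.sum_comp (Equiv.inv (ZMod q)ˣ)]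
  refine Finset.sum_congr rfl fun u _ => ?_
  simp only [Equiv.inv_apply, inv_inv]
  rw [add_comm]

theorem norm_kloostermanSum_le_self {q : ℕ} [NeZero q] (ψ : AddChar (ZMod q) ℂ) (m n : ZMod q) :
    ‖kloostermanSum ψ m n‖ ≤ q := by
  unfold kloostermanSum
  refine (norm_sum_le _ _).trans ?_
  simp only [AddChar.norm_apply, Finset.sum_const, nsmul_eq_mul, mul_one, Finset.card_univ]
  rw [ZMod.card_units_eq_totient]
  exact_mod_cast Nat.totient_le q

theorem kloostermanSum_prime {p : ℕ} [Fact p.Prime] (ψ : AddChar (ZMod p) ℂ) (m n : ZMod p) :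
    kloostermanSum ψ m n = ∑ x ∈ Finset.univ.erase (0 : ZMod p), ψ (m * x + n * x⁻¹) := by
  unfold kloostermanSum
  rw [← Finset.filter_ne']
  refine Finset.sum_bij (fun t _ => (t : ZMod p)) ?_ ?_ ?_ ?_
  · intro t _
    simp
  · intro t _ s _ h
    exact Units.ext h
  · intro t ht
    exact ⟨Units.mk0 t (Finset.mem_filter.1 ht).2, Finset.mem_univ _, rfl⟩
  · intro t _
    rw [Units.val_inv_eq_inv_val]

theorem AddChar.IsPrimitive.ne_one_of_one_lt {q : ℕ} (hq : 1 < q) {ψ : AddChar (ZMod q) ℂ}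
    (hψ : ψ.IsPrimitive) : ψ ≠ 1 := by
  have : Fact (1 < q) := ⟨hq⟩
  have := hψ (one_ne_zero (α := ZMod q))
  rwa [AddChar.mulShift_one] at this

theorem norm_kloostermanSum_prime_le {p : ℕ} [Fact p.Prime] {ψ : AddChar (ZMod p) ℂ}
    (hψ : ψ.IsPrimitive) (m n : ℕ) :
    ‖kloostermanSum ψ m n‖ ≤ 8 * √(p : ℝ) * Nat.gcd (Nat.gcd m n) p := by
  have hp : p.Prime := Fact.out
  have hψ1 := AddChar.IsPrimitive.ne_one_of_one_lt hp.one_lt hψ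
  have hs1 : 1 ≤ √(p : ℝ) := Real.one_le_sqrt.2 (by exact_mod_cast hp.one_le)
  have hg : (1 : ℝ) ≤ Nat.gcd (Nat.gcd m n) p := by
    exact_mod_cast Nat.gcd_pos_of_pos_right _ hp.pos
  have hlin : ∀ a : ZMod p, a ≠ 0 → ‖kloostermanSum ψ a 0‖ ≤ 1 := by
    intro a ha
    rw [kloostermanSum_prime]
    have h1 := AddChar.sum_mulShift a hψ
    rw [if_neg ha, ← Finset.add_sum_erase _ _ (Finset.mem_univ 0)] at h1
    simp only [zero_mul, AddChar.map_zero_eq_one, add_zero, Nat.cast_zero] at h1 ⊢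
    have h2 : ∑ x ∈ Finset.univ.erase (0 : ZMod p), ψ (a * x) = -1 := by
      simp_rw [mul_comm a]
      linear_combination h1
    rw [h2]
    simp
  by_cases hm : (m : ZMod p) = 0
  · by_cases hn : (n : ZMod p) = 0
    · rw [ZMod.natCast_eq_zero_iff] at hm hn
      have hgp : Nat.gcd (Nat.gcd m n) p = p := Nat.gcd_eq_right (Nat.dvd_gcd hm hn)
      rw [hgp]
      refine (norm_kloostermanSum_le_self ψ _ _).trans ?_
      exact le_mul_of_one_le_left (Nat.cast_nonneg _) (by linarith)
    · rw [hm, kloostermanSum_comm]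
      refine (hlin _ hn).trans ?_
      nlinarith
  · by_cases hn : (n : ZMod p) = 0
    · rw [hn]
      refine (hlin _ hm).trans ?_
      nlinarith
    · rw [kloostermanSum_prime]
      refine (norm_kloosterman_prime_le hψ1 hm hn).trans ?_
      nlinarith

theorem norm_kloostermanSum_prime_pow_le {p k q : ℕ} [NeZero q] (hp : p.Prime) (hk : 1 ≤ k)
    (hq : q = p ^ k) {ψ : AddChar (ZMod q) ℂ} (hψ : ψ.IsPrimitive) (m n : ℕ) :
    ‖kloostermanSum ψ m n‖ ≤ 8 * √(q : ℝ) * Nat.gcd (Nat.gcd m n) q := by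
  have hqpos : 0 < q := NeZero.pos q
  have hg : (1 : ℝ) ≤ Nat.gcd (Nat.gcd m n) q := by
    exact_mod_cast Nat.gcd_pos_of_pos_right _ hqpos
  have hs : 0 ≤ √(q : ℝ) := Real.sqrt_nonneg _
  have hzero : ∀ z : ℕ, p ^ k ∣ z → (z : ZMod q) = 0 := fun z hz =>
    (ZMod.natCast_eq_zero_iff _ _).2 (hq ▸ hz)
  have hnil : ∀ s, 1 ≤ s → IsNilpotent ((p ^ s : ℕ) : ZMod q) := by
    intro s hs
    refine ⟨k, ?_⟩
    rw [← Nat.cast_pow, ← pow_mul]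
    exact hzero _ (Nat.pow_dvd_pow p (by nlinarith))
  have hsimple : ∀ s a b : ℕ, 1 ≤ s → p ^ k ∣ b * p ^ (2 * s) →
      ‖kloostermanSum ψ a b‖ ≤ 4 * p ^ s * Nat.gcd (Nat.gcd a b) q := by
    intro s a b hs1 hb
    refine (norm_kloostermanSum_le_card hψ a b _ (hnil s hs1) ?_).trans ?_
    · rw [← Nat.cast_pow, ← Nat.cast_mul, ← pow_mul, mul_comm s]
      exact hzero _ hb
    · exact_mod_cast card_quadratic_solutions_le hp hq a b
  rcases Nat.even_or_odd' k with ⟨l, hl | hl⟩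
  · refine (hsimple l m n (by omega) (hl ▸ dvd_mul_left _ _)).trans ?_
    have h1 : √(q : ℝ) = p ^ l := by
      rw [hq, hl, pow_mul']
      push_cast
      exact Real.sqrt_sq (by positivity)
    rw [h1]
    refine mul_le_mul_of_nonneg_right ?_ (Nat.cast_nonneg _)
    have : (0 : ℝ) ≤ p ^ l := by positivity
    linarith
  rcases Nat.eq_zero_or_pos l with rfl | hlpos
  · rw [hl] at hq
    simp only [mul_zero, zero_add, pow_one] at hq
    subst hq
    have : Fact q.Prime := ⟨hp⟩
    exact norm_kloostermanSum_prime_le hψ m n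
  have hpl : (p : ℝ) ^ l ≤ √(q : ℝ) := by
    refine Real.le_sqrt_of_sq_le ?_
    rw [← pow_mul, hq, hl]
    exact_mod_cast Nat.pow_le_pow_right hp.pos (by omega)
  by_cases hp2 : p = 2
  · refine (hsimple (l + 1) m n (by omega)
      (Dvd.dvd.mul_left (Nat.pow_dvd_pow _ (by omega)) _)).trans ?_
    refine mul_le_mul_of_nonneg_right ?_ (Nat.cast_nonneg _)
    have h2 : (p : ℝ) = 2 := by rw [hp2, Nat.cast_ofNat]
    rw [pow_succ]
    rw [h2] at hpl ⊢
    linarith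
  by_cases hn : p ∣ n
  · refine (hsimple l m n (by omega) ?_).trans ?_
    · rw [hl, pow_succ, mul_comm]
      exact mul_dvd_mul_right hn _
    · refine mul_le_mul_of_nonneg_right ?_ (Nat.cast_nonneg _)
      linarith
  · refine (norm_kloostermanSum_odd_exponent_le hp hp2 hlpos (hl ▸ hq) hψ m n hn).trans ?_
    nlinarith

end primePowerBound

section chineseRemainder

theorem exists_kloostermanSum_eq_mul {q₁ q₂ : ℕ} [NeZero q₁] [NeZero q₂] [NeZero (q₁ * q₂)]
    (hcop : Nat.Coprime q₁ q₂) {ψ : AddChar (ZMod (q₁ * q₂)) ℂ} (hψ : ψ.IsPrimitive) (m n : ℕ) :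
    ∃ (ψ₁ : AddChar (ZMod q₁) ℂ) (ψ₂ : AddChar (ZMod q₂) ℂ), ψ₁.IsPrimitive ∧ ψ₂.IsPrimitive ∧
      kloostermanSum ψ m n = kloostermanSum ψ₁ m n * kloostermanSum ψ₂ m n := by
  let e := ZMod.chineseRemainder hcop
  let ψ₁ : AddChar (ZMod q₁) ℂ := ψ.compAddMonoidHom
    (e.symm.toAddMonoidHom.comp (AddMonoidHom.inl (ZMod q₁) (ZMod q₂)))
  let ψ₂ : AddChar (ZMod q₂) ℂ := ψ.compAddMonoidHom
    (e.symm.toAddMonoidHom.comp (AddMonoidHom.inr (ZMod q₁) (ZMod q₂)))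
  have h1 : ∀ x, ψ₁ x = ψ (e.symm (x, 0)) := fun x => rfl
  have h2 : ∀ x, ψ₂ x = ψ (e.symm (0, x)) := fun x => rfl
  have h12 : ∀ x, ψ x = ψ₁ (e x).1 * ψ₂ (e x).2 := by
    intro x
    rw [h1, h2, ← AddChar.map_add_eq_mul, ← map_add]
    simp
  refine ⟨ψ₁, ψ₂, ?_, ?_, ?_⟩
  · intro a ha
    obtain ⟨x, hx⟩ := AddChar.ne_one_iff.1 (hψ (a := e.symm (a, 0)) (by
      rw [Ne, map_eq_zero_iff _ e.symm.injective]
      simpa using ha))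
    refine AddChar.ne_one_iff.2 ⟨(e x).1, ?_⟩
    rw [AddChar.mulShift_apply] at hx ⊢
    rw [h12] at hx
    simpa [AddChar.map_zero_eq_one] using hx
  · intro a ha
    obtain ⟨x, hx⟩ := AddChar.ne_one_iff.1 (hψ (a := e.symm (0, a)) (by
      rw [Ne, map_eq_zero_iff _ e.symm.injective]
      simpa using ha))
    refine AddChar.ne_one_iff.2 ⟨(e x).2, ?_⟩
    rw [AddChar.mulShift_apply] at hx ⊢
    rw [h12] at hx
    simpa [AddChar.map_zero_eq_one] using hx
  · unfold kloostermanSum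
    rw [Finset.sum_mul_sum, ← Fintype.sum_prod_type']
    let E : (ZMod (q₁ * q₂))ˣ ≃ (ZMod q₁)ˣ × (ZMod q₂)ˣ :=
      ((Units.mapEquiv e.toMulEquiv).trans MulEquiv.prodUnits).toEquiv
    rw [← Equiv.sum_comp E]
    refine Finset.sum_congr rfl fun u _ => ?_
    rw [h12, map_add, map_mul, map_mul, map_natCast, map_natCast]
    rfl

end chineseRemainder

section compositeModulus

theorem norm_kloostermanSum_le {q : ℕ} [NeZero q] {ψ : AddChar (ZMod q) ℂ} (hψ : ψ.IsPrimitive)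
    (m n : ℕ) :
    ‖kloostermanSum ψ m n‖ ≤
      (q.divisors.card : ℝ) ^ 3 * √(q : ℝ) * Nat.gcd (Nat.gcd m n) q := by
  suffices h : ∀ q : ℕ, ∀ [NeZero q] (ψ : AddChar (ZMod q) ℂ), ψ.IsPrimitive →
      ‖kloostermanSum ψ m n‖ ≤
        (q.divisors.card : ℝ) ^ 3 * √(q : ℝ) * Nat.gcd (Nat.gcd m n) q from h q ψ hψ
  intro q
  induction q using Nat.recOnPosPrimePosCoprime with
  | prime_pow p k hp hk =>
    intro _ ψ hψ
    refine (norm_kloostermanSum_prime_pow_le hp hk rfl hψ m n).trans ?_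
    gcongr
    rw [Nat.divisors_prime_pow hp, Finset.card_map, Finset.card_range]
    have : (2 : ℝ) ≤ ((k + 1 : ℕ) : ℝ) := by exact_mod_cast (by omega : 2 ≤ k + 1)
    calc (8 : ℝ) = 2 ^ 3 := by norm_num
      _ ≤ _ := by gcongr
  | zero =>
    intro h
    exact absurd rfl h.out
  | one =>
    intro _ ψ _
    refine (norm_kloostermanSum_le_self ψ _ _).trans ?_
    simp
  | coprime a b ha hb hab iha ihb =>
    intro _ ψ hψ
    have : NeZero a := ⟨by omega⟩
    have : NeZero b := ⟨by omega⟩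
    obtain ⟨ψ₁, ψ₂, h₁, h₂, h⟩ := exists_kloostermanSum_eq_mul hab hψ m n
    rw [h, norm_mul]
    refine (mul_le_mul (iha ψ₁ h₁) (ihb ψ₂ h₂) (norm_nonneg _) (by positivity)).trans ?_
    rw [hab.card_divisors_mul, hab.gcd_mul]
    push_cast
    rw [Real.sqrt_mul (Nat.cast_nonneg _)]
    apply le_of_eq
    ring

end compositeModulus

section divisorBound

theorem card_divisors_le_pow_mul_rpow {ε K : ℝ} {P : ℕ} (hε : 0 < ε) (hK : 1 ≤ K)
    (hsmall : ∀ k : ℕ, (k + 1 : ℝ) ≤ K * ((2 : ℝ) ^ ε) ^ k) (hlarge : (2 : ℝ) ≤ (P : ℝ) ^ ε)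
    (q : ℕ) :
    q ≠ 0 → (q.divisors.card : ℝ) ≤ K ^ (q.primeFactors.filter (· < P)).card * (q : ℝ) ^ ε := by
  induction q using Nat.recOnPosPrimePosCoprime with
  | zero => exact fun h => absurd rfl h
  | one => simp
  | prime_pow p k hp hk =>
    intro _
    rw [Nat.divisors_prime_pow hp, Finset.card_map, Finset.card_range,
      Nat.primeFactors_prime_pow hk.ne' hp, Nat.cast_pow, ← Real.rpow_natCast_mul (by positivity),
      mul_comm (k : ℝ), Real.rpow_mul_natCast (by positivity), Finset.filter_singleton]
    push_cast
    split_ifs with hpP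
    · rw [Finset.card_singleton, pow_one]
      refine (hsmall k).trans ?_
      have : (2 : ℝ) ≤ p := by exact_mod_cast hp.two_le
      gcongr
    · rw [Finset.card_empty, pow_zero, one_mul]
      have h2 : (2 : ℝ) ≤ (p : ℝ) ^ ε := by
        refine hlarge.trans (Real.rpow_le_rpow (by positivity) ?_ hε.le)
        exact_mod_cast not_lt.1 hpP
      calc (k + 1 : ℝ) ≤ 2 ^ k := by exact_mod_cast Nat.lt_two_pow_self
        _ ≤ _ := by gcongr
  | coprime a b ha hb hab iha ihb =>
    intro _
    rw [hab.card_divisors_mul, hab.primeFactors_mul, Finset.filter_union,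
      Finset.card_union_of_disjoint
        (Finset.disjoint_filter_filter hab.disjoint_primeFactors), pow_add]
    push_cast
    rw [Real.mul_rpow (by positivity) (by positivity)]
    calc _ ≤ _ := mul_le_mul (iha (by omega)) (ihb (by omega)) (by positivity) (by positivity)
      _ = _ := by ring

/-- The divisor function grows slower than any positive power. -/
theorem exists_card_divisors_le_rpow {ε : ℝ} (hε : 0 < ε) :
    ∃ C : ℝ, 1 ≤ C ∧ ∀ q : ℕ, q ≠ 0 → (q.divisors.card : ℝ) ≤ C * (q : ℝ) ^ ε := by
  obtain ⟨P, hP⟩ := exists_nat_ge ((2 : ℝ) ^ ε⁻¹)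
  have hlarge : (2 : ℝ) ≤ (P : ℝ) ^ ε := by
    calc (2 : ℝ) = ((2 : ℝ) ^ ε⁻¹) ^ ε := (Real.rpow_inv_rpow (by norm_num) hε.ne').symm
      _ ≤ _ := Real.rpow_le_rpow (by positivity) hP hε.le
  have hc : 0 < ε * Real.log 2 := by positivity
  set K : ℝ := 1 + (ε * Real.log 2)⁻¹ with hKdef
  have hK : 1 ≤ K := by
    have := inv_pos.2 hc
    linarith
  have hsmall : ∀ k : ℕ, (k + 1 : ℝ) ≤ K * ((2 : ℝ) ^ ε) ^ k := by
    intro k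
    have h1 : ((2 : ℝ) ^ ε) ^ k = Real.exp (k * (ε * Real.log 2)) := by
      rw [Real.rpow_def_of_pos (by norm_num), ← Real.exp_nat_mul, mul_comm ε]
    rw [h1]
    have h2 := Real.add_one_le_exp (k * (ε * Real.log 2))
    have h3 : (ε * Real.log 2)⁻¹ * (ε * Real.log 2) = 1 := inv_mul_cancel₀ hc.ne'
    calc (k + 1 : ℝ) = 1 + k * ((ε * Real.log 2)⁻¹ * (ε * Real.log 2)) := by rw [h3]; ring
      _ ≤ K * (k * (ε * Real.log 2) + 1) := by
        have := inv_pos.2 hc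
        rw [hKdef]
        nlinarith [mul_nonneg (Nat.cast_nonneg (α := ℝ) k) hc.le]
      _ ≤ _ := by gcongr
  refine ⟨K ^ P, one_le_pow₀ hK, fun q hq => ?_⟩
  refine (card_divisors_le_pow_mul_rpow hε hK hsmall hlarge q hq).trans ?_
  gcongr
  calc _ ≤ (Finset.range P).card := Finset.card_le_card fun x hx => by
        simpa using (Finset.mem_filter.1 hx).2
    _ = P := Finset.card_range P

end divisorBound

section intervals

theorem toReal_volume_le_of_subset_Icc {I : Set ℝ} {a b : ℝ} (hab : a ≤ b)
    (h : I ⊆ Set.Icc a b) : (volume I).toReal ≤ b - a := by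
  have := ENNReal.toReal_mono (by simp) (measure_mono (μ := volume) h)
  rwa [Real.volume_Icc, ENNReal.toReal_ofReal (sub_nonneg.2 hab)] at this

/-- The natural numbers in a subinterval of `[0, q)` form a block of consecutive integers whose
size differs from the length by at most one. -/
theorem exists_natCast_mem_iff_of_ordConnected {q : ℕ} {I : Set ℝ} (hI : I.OrdConnected)
    (hIq : I ⊆ Set.Ico 0 (q : ℝ)) :
    ∃ c d : ℕ, c ≤ d ∧ d ≤ q ∧ (∀ x : ℕ, (x : ℝ) ∈ I ↔ c ≤ x ∧ x < d) ∧
      |((d - c : ℕ) : ℝ) - (volume I).toReal| ≤ 1 := by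
  have hlt : ∀ x : ℕ, (x : ℝ) ∈ I → x < q := fun x hx => by exact_mod_cast (hIq hx).2
  by_cases hne : ∃ x : ℕ, (x : ℝ) ∈ I
  · obtain ⟨c, hc, hcmin⟩ : ∃ c : ℕ, (c : ℝ) ∈ I ∧ ∀ x : ℕ, (x : ℝ) ∈ I → c ≤ x :=
      ⟨Nat.find hne, Nat.find_spec hne, fun x hx => Nat.find_min' hne hx⟩
    obtain ⟨e, he, hemax⟩ : ∃ e : ℕ, (e : ℝ) ∈ I ∧ ∀ x : ℕ, (x : ℝ) ∈ I → x ≤ e := by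
      have hs : ((Finset.range q).filter fun x : ℕ => (x : ℝ) ∈ I).Nonempty := by
        exact ⟨c, by simpa using ⟨hlt c hc, hc⟩⟩
      refine ⟨_, (Finset.mem_filter.1 (Finset.max'_mem _ hs)).2, fun x hx => ?_⟩
      exact Finset.le_max' _ _ (by simpa using ⟨hlt x hx, hx⟩)
    have hce := hcmin e he
    refine ⟨c, e + 1, by omega, hlt e he, fun x => ⟨fun hx => ⟨hcmin x hx, ?_⟩, fun hx => ?_⟩, ?_⟩
    · exact Nat.lt_succ_of_le (hemax x hx)
    · exact hI.out hc he ⟨by exact_mod_cast hx.1, by exact_mod_cast Nat.le_of_lt_succ hx.2⟩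
    · have hcast : ((e + 1 - c : ℕ) : ℝ) = e + 1 - c := by
        rw [Nat.cast_sub (by omega)]
        push_cast
        ring
      have hce' : (c : ℝ) ≤ e := by exact_mod_cast hce
      have hsub : I ⊆ Set.Icc ((c : ℝ) - 1) (e + 1) := by
        intro y hy
        constructor
        · by_contra! hlt'
          have h0 := (hIq hy).1
          have hc1 : 1 ≤ c := by
            have : (0 : ℝ) < c := by linarith
            exact_mod_cast this
          have : ((c - 1 : ℕ) : ℝ) ∈ I := hI.out hy hc ⟨by
            rw [Nat.cast_sub hc1]; push_cast; linarith, by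
            rw [Nat.cast_sub hc1]; push_cast; linarith⟩
          have := hcmin _ this
          omega
        · by_contra! hlt'
          have : ((e + 1 : ℕ) : ℝ) ∈ I := hI.out he hy ⟨by push_cast; linarith, by
            push_cast; linarith⟩
          have := hemax _ this
          omega
      have hup := toReal_volume_le_of_subset_Icc (by linarith) hsub
      have hlow : (e : ℝ) - c ≤ (volume I).toReal := by
        have := ENNReal.toReal_mono (measure_lt_top_of_subset hsub (by simp)).ne
          (measure_mono (μ := volume) (hI.out hc he))
        rwa [Real.volume_Icc, ENNReal.toReal_ofReal (sub_nonneg.2 hce')] at this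
      rw [hcast, abs_le]
      constructor <;> linarith
  · push Not at hne
    refine ⟨0, 0, le_rfl, Nat.zero_le _, fun x => ⟨fun hx => absurd hx (hne x), by omega⟩, ?_⟩
    have hle : (volume I).toReal ≤ 1 := by
      rcases I.eq_empty_or_nonempty with rfl | ⟨x, hx⟩
      · simp
      · have hx0 := (hIq hx).1
        have hfl := Nat.floor_le hx0
        have hfl' := (Nat.lt_floor_add_one x).le
        have hsub : I ⊆ Set.Icc (⌊x⌋₊ : ℝ) (⌊x⌋₊ + 1) := by
          intro y hy
          constructor
          · by_contra! hlt'
            exact hne _ (hI.out hy hx ⟨hlt'.le, hfl⟩)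
          · by_contra! hlt'
            exact hne (⌊x⌋₊ + 1) (hI.out hx hy ⟨by push_cast; linarith, by push_cast; linarith⟩)
        have := toReal_volume_le_of_subset_Icc (by linarith) hsub
        linarith
    have h0 : 0 ≤ (volume I).toReal := ENNReal.toReal_nonneg
    rw [abs_le]
    constructor <;> norm_num <;> linarith

end intervals

section exponentialSums

theorem norm_sum_Ico_pow_mul_le {z : ℂ} (hz : ‖z‖ = 1) (c d : ℕ) (hcd : c ≤ d) :
    ‖∑ j ∈ Finset.Ico c d, z ^ j‖ * ‖z - 1‖ ≤ 2 := by
  rw [← norm_mul, geom_sum_Ico_mul z hcd]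
  refine (norm_sub_le _ _).trans ?_
  simp [hz]
  norm_num

theorem four_mul_min_le_norm_stdAddChar_sub_one {q : ℕ} [NeZero q] (m : ZMod q) :
    4 * (min m.val (q - m.val) : ℕ) ≤ q * ‖ZMod.stdAddChar (-m) - 1‖ := by
  have hq : (0 : ℝ) < q := by exact_mod_cast NeZero.pos q
  have hm := m.val_lt
  have hnorm : ‖ZMod.stdAddChar (-m) - 1‖ = 2 * Real.sin (π * m.val / q) := by
    have h1 : ‖ZMod.stdAddChar (-m) - 1‖ = ‖ZMod.stdAddChar m - 1‖ := by
      rw [AddChar.map_neg_eq_conj, ← map_one (starRingEnd ℂ), ← map_sub, RCLike.norm_conj, map_one]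
    rw [h1]
    conv_lhs => rw [← ZMod.natCast_zmod_val m]
    have h2 := ZMod.stdAddChar_coe (N := q) (m.val : ℤ)
    push_cast at h2
    rw [h2]
    have h3 : 2 * π * Complex.I * m.val / q = Complex.I * ((2 * (π * m.val / q) : ℝ) : ℂ) := by
      push_cast
      ring
    rw [h3, Complex.norm_exp_I_mul_ofReal_sub_one, mul_div_cancel_left₀ _ two_ne_zero,
      Real.norm_eq_abs, abs_of_nonneg]
    refine mul_nonneg zero_le_two (Real.sin_nonneg_of_nonneg_of_le_pi (by positivity) ?_)
    rw [div_le_iff₀ hq]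
    gcongr
  rw [hnorm]
  rcases le_total (2 * m.val) q with h | h
  · have hmin : min m.val (q - m.val) = m.val := by omega
    have h' : 2 * (m.val : ℝ) ≤ q := by exact_mod_cast h
    rw [hmin]
    have := Real.mul_le_sin (x := π * m.val / q) (by positivity) (by
      rw [div_le_div_iff₀ hq two_pos]
      nlinarith [Real.pi_pos])
    have h2 : 2 / π * (π * m.val / q) = 2 * m.val / q := by
      field_simp
    rw [h2, div_le_iff₀ hq] at this
    linarith
  · have hmin : min m.val (q - m.val) = q - m.val := by omega
    have h' : (q : ℝ) ≤ 2 * (m.val : ℝ) := by exact_mod_cast h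
    have hm' : (m.val : ℝ) ≤ q := by exact_mod_cast hm.le
    rw [hmin, Nat.cast_sub hm.le, ← Real.sin_pi_sub]
    have h3 : π - π * m.val / q = π * (q - m.val) / q := by
      field_simp
    rw [h3]
    have := Real.mul_le_sin (x := π * (q - m.val) / q)
      (div_nonneg (mul_nonneg Real.pi_pos.le (by linarith)) hq.le) (by
      rw [div_le_div_iff₀ hq two_pos]
      nlinarith [Real.pi_pos])
    have h2 : 2 / π * (π * (q - m.val) / q) = 2 * (q - m.val) / q := by
      field_simp
    rw [h2, div_le_iff₀ hq] at this
    linarith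

/-- The Fourier coefficients of an interval of residues decay like those of a sawtooth. -/
theorem norm_sum_Ico_stdAddChar_le {q : ℕ} [NeZero q] {m : ZMod q} (hm : m ≠ 0) {c d : ℕ}
    (hcd : c ≤ d) :
    ‖∑ j ∈ Finset.Ico c d, ZMod.stdAddChar (-m * (j : ZMod q))‖ ≤
      q * ((m.val : ℝ)⁻¹ + ((q - m.val : ℕ) : ℝ)⁻¹) := by
  have hq : (0 : ℝ) < q := by exact_mod_cast NeZero.pos q
  have hpow : ∀ j : ℕ, ZMod.stdAddChar (-m * (j : ZMod q)) = ZMod.stdAddChar (-m) ^ j := by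
    intro j
    rw [← AddChar.map_nsmul_eq_pow, nsmul_eq_mul, mul_comm]
  simp_rw [hpow]
  have h1 := norm_sum_Ico_pow_mul_le (AddChar.norm_apply ZMod.stdAddChar (-m)) c d hcd
  have h2 := four_mul_min_le_norm_stdAddChar_sub_one m
  set S := ‖∑ j ∈ Finset.Ico c d, ZMod.stdAddChar (-m) ^ j‖
  have hS : 0 ≤ S := norm_nonneg _
  have hv : 0 < m.val := Nat.pos_of_ne_zero ((ZMod.val_ne_zero m).2 hm)
  have hv' : 0 < q - m.val := Nat.sub_pos_of_lt m.val_lt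
  set t := min m.val (q - m.val) with ht
  have htpos : (0 : ℝ) < (t : ℕ) := by exact_mod_cast (lt_min hv hv')
  have h3 : S * t ≤ q := by
    have : S * (4 * (t : ℝ)) ≤ S * (q * ‖ZMod.stdAddChar (-m) - 1‖) := by gcongr
    nlinarith
  have h4 : S ≤ q * (t : ℝ)⁻¹ := by
    rw [← div_eq_mul_inv, le_div_iff₀ htpos]
    exact h3
  refine h4.trans ?_
  gcongr
  rcases min_choice m.val (q - m.val) with h | h <;> rw [← ht] at h <;> rw [h]
  · exact le_add_of_nonneg_right (by positivity)
  · exact le_add_of_nonneg_left (by positivity)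

end exponentialSums

section gcdSums

theorem sum_gcd_mul_inv_le {q : ℕ} (hq : q ≠ 0) :
    ∑ n ∈ Finset.range q, (n : ℝ)⁻¹ * Nat.gcd n q ≤ q.divisors.card * (1 + Real.log q) := by
  have hH : ∑ j ∈ Finset.Icc 1 q, (j : ℝ)⁻¹ ≤ 1 + Real.log q := by
    have := harmonic_le_one_add_log q
    rw [harmonic_eq_sum_Icc] at this
    push_cast at this
    exact this
  calc ∑ n ∈ Finset.range q, (n : ℝ)⁻¹ * Nat.gcd n q
      ≤ ∑ n ∈ Finset.range q, ∑ d ∈ q.divisors, if d ∣ n then (n : ℝ)⁻¹ * d else 0 := by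
        refine Finset.sum_le_sum fun n _ => ?_
        have hg : Nat.gcd n q ∈ q.divisors := Nat.mem_divisors.2 ⟨Nat.gcd_dvd_right _ _, hq⟩
        refine le_trans ?_ (Finset.single_le_sum (fun d _ => ?_) hg)
        · rw [if_pos (Nat.gcd_dvd_left _ _)]
        · split_ifs <;> positivity
    _ = ∑ d ∈ q.divisors, ∑ n ∈ Finset.range q with d ∣ n, (n : ℝ)⁻¹ * d := by
        rw [Finset.sum_comm]
        simp_rw [Finset.sum_filter]
    _ ≤ ∑ d ∈ q.divisors, (1 + Real.log q) := by
        refine Finset.sum_le_sum fun d hd => le_trans ?_ hH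
        have hd0 : 0 < d := Nat.pos_of_mem_divisors hd
        calc ∑ n ∈ Finset.range q with d ∣ n, (n : ℝ)⁻¹ * d
            ≤ ∑ n ∈ (Finset.Icc 0 q).image (fun j => j * d), (n : ℝ)⁻¹ * d := by
              refine Finset.sum_le_sum_of_subset_of_nonneg (fun n hn => ?_)
                fun _ _ _ => by positivity
              obtain ⟨hn, j, rfl⟩ := Finset.mem_filter.1 hn
              rw [Finset.mem_range] at hn
              exact Finset.mem_image.2 ⟨j, Finset.mem_Icc.2 ⟨Nat.zero_le _, by nlinarith⟩,
                mul_comm _ _⟩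
          _ = ∑ j ∈ Finset.Icc 0 q, (j : ℝ)⁻¹ := by
              rw [Finset.sum_image fun a _ b _ h => Nat.eq_of_mul_eq_mul_right hd0 h]
              refine Finset.sum_congr rfl fun j _ => ?_
              have : (d : ℝ) ≠ 0 := by exact_mod_cast hd0.ne'
              push_cast
              rw [mul_inv, inv_mul_cancel_right₀ this]
          _ = ∑ j ∈ Finset.Icc 1 q, (j : ℝ)⁻¹ := by
              rw [← Finset.add_sum_Ioc_eq_sum_Icc (Nat.zero_le q)]
              simp only [Nat.cast_zero, inv_zero, zero_add]
              rfl
    _ = _ := by rw [Finset.sum_const, nsmul_eq_mul]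

/-- The weight of a nonzero frequency. -/
noncomputable def frequencyWeight {q : ℕ} (m : ZMod q) : ℝ :=
  (m.val : ℝ)⁻¹ + ((q - m.val : ℕ) : ℝ)⁻¹

theorem frequencyWeight_nonneg {q : ℕ} (m : ZMod q) : 0 ≤ frequencyWeight m := by
  unfold frequencyWeight
  positivity

theorem sum_val_eq_sum_range {q : ℕ} [NeZero q] (f : ℕ → ℝ) :
    ∑ m : ZMod q, f m.val = ∑ n ∈ Finset.range q, f n := by
  refine Finset.sum_bij (fun m _ => m.val) (fun m _ => Finset.mem_range.2 m.val_lt)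
    (fun a _ b _ h => ZMod.val_injective q h) (fun n hn => ?_) fun _ _ => rfl
  exact ⟨n, Finset.mem_univ _, ZMod.val_natCast_of_lt (Finset.mem_range.1 hn)⟩

theorem sum_frequencyWeight_mul_gcd_le {q : ℕ} [NeZero q] :
    ∑ m ∈ Finset.univ.erase (0 : ZMod q), frequencyWeight m * Nat.gcd m.val q ≤
      2 * (q.divisors.card * (1 + Real.log q)) := by
  have hsum : ∑ m : ZMod q, (m.val : ℝ)⁻¹ * Nat.gcd m.val q ≤
      q.divisors.card * (1 + Real.log q) :=
    (sum_val_eq_sum_range fun n => (n : ℝ)⁻¹ * Nat.gcd n q).trans_le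
      (sum_gcd_mul_inv_le (NeZero.ne q))
  have hsum' : ∑ m : ZMod q, ((-m).val : ℝ)⁻¹ * Nat.gcd (-m).val q ≤
      q.divisors.card * (1 + Real.log q) := by
    exact (Equiv.sum_comp (Equiv.neg (ZMod q)) fun m =>
      (m.val : ℝ)⁻¹ * Nat.gcd m.val q).trans_le hsum
  calc _ ≤ ∑ m ∈ Finset.univ.erase (0 : ZMod q), ((m.val : ℝ)⁻¹ * Nat.gcd m.val q +
        ((-m).val : ℝ)⁻¹ * Nat.gcd (-m).val q) := by
        refine Finset.sum_le_sum fun m hm => le_of_eq ?_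
        rw [ZMod.neg_val, if_neg (Finset.ne_of_mem_erase hm),
          Nat.gcd_self_sub_left m.val_lt.le, frequencyWeight, add_mul]
    _ ≤ ∑ m : ZMod q, ((m.val : ℝ)⁻¹ * Nat.gcd m.val q +
        ((-m).val : ℝ)⁻¹ * Nat.gcd (-m).val q) :=
        Finset.sum_le_sum_of_subset_of_nonneg (Finset.subset_univ _) fun _ _ _ => by positivity
    _ ≤ _ := by
        rw [Finset.sum_add_distrib]
        linarith

end gcdSums

section fourierExpansion

variable {q : ℕ} [NeZero q]

/-- The Fourier coefficient at `m` of the indicator function of `A`. -/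
noncomputable def fourierCoefficient (A : Finset (ZMod q)) (m : ZMod q) : ℂ :=
  ∑ a ∈ A, ZMod.stdAddChar (-m * a)

theorem fourierCoefficient_zero (A : Finset (ZMod q)) : fourierCoefficient A 0 = A.card := by
  simp [fourierCoefficient]

theorem sum_fourierCoefficient_mul (A : Finset (ZMod q)) (x : ZMod q) :
    ∑ m, fourierCoefficient A m * ZMod.stdAddChar (m * x) = if x ∈ A then (q : ℂ) else 0 := by
  unfold fourierCoefficient
  simp_rw [Finset.sum_mul, ← AddChar.map_add_eq_mul]
  rw [Finset.sum_comm]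
  have h : ∀ a, ∑ m : ZMod q, ZMod.stdAddChar (-m * a + m * x) = if x = a then (q : ℂ) else 0 := by
    intro a
    have := AddChar.sum_mulShift (x - a) (ZMod.isPrimitive_stdAddChar q)
    rw [ZMod.card] at this
    simp_rw [sub_eq_zero] at this
    push_cast at this
    rw [← this]
    refine Finset.sum_congr rfl fun m _ => ?_
    congr 1
    ring
  simp_rw [h]
  rw [Finset.sum_ite_eq]

/-- The number of points of `A × B` on the modular hyperbola `x * y = h` with `x` invertible. -/
noncomputable def hyperbolaCount (A B : Finset (ZMod q)) (h : ZMod q) : ℕ :=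
  (Finset.univ.filter fun u : (ZMod q)ˣ =>
    (u : ZMod q) ∈ A ∧ h * ((u⁻¹ : (ZMod q)ˣ) : ZMod q) ∈ B).card

theorem sq_mul_hyperbolaCount (A B : Finset (ZMod q)) (h : ZMod q) :
    (q : ℂ) ^ 2 * hyperbolaCount A B h =
      ∑ n, ∑ m, fourierCoefficient A m * fourierCoefficient B n *
        kloostermanSum ZMod.stdAddChar m (n * h) := by
  unfold kloostermanSum
  simp_rw [Finset.mul_sum]
  have hswap : ∀ F : ZMod q → ZMod q → (ZMod q)ˣ → ℂ,
      ∑ n, ∑ m, ∑ u, F n m u = ∑ u, ∑ n, ∑ m, F n m u := by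
    intro F
    rw [Finset.sum_comm (s := Finset.univ (α := (ZMod q)ˣ))]
    exact Finset.sum_congr rfl fun n _ => Finset.sum_comm
  rw [hswap]
  have h1 : ∀ u : (ZMod q)ˣ, ∑ n, ∑ m, fourierCoefficient A m * fourierCoefficient B n *
      ZMod.stdAddChar (m * (u : ZMod q) + n * h * ((u⁻¹ : (ZMod q)ˣ) : ZMod q)) =
      if (u : ZMod q) ∈ A ∧ h * ((u⁻¹ : (ZMod q)ˣ) : ZMod q) ∈ B then (q : ℂ) ^ 2 else 0 := by
    intro u
    have h2 := sum_fourierCoefficient_mul A u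
    have h3 := sum_fourierCoefficient_mul B (h * ((u⁻¹ : (ZMod q)ˣ) : ZMod q))
    calc _ = (∑ n, fourierCoefficient B n *
            ZMod.stdAddChar (n * (h * ((u⁻¹ : (ZMod q)ˣ) : ZMod q)))) *
          ∑ m, fourierCoefficient A m * ZMod.stdAddChar (m * (u : ZMod q)) := by
          rw [Finset.sum_mul_sum]
          refine Finset.sum_congr rfl fun n _ => Finset.sum_congr rfl fun m _ => ?_
          rw [AddChar.map_add_eq_mul, mul_assoc n]
          ring
      _ = _ := by
          rw [h2, h3]
          split_ifs <;> simp_all [pow_two]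
  simp_rw [h1]
  rw [← Finset.sum_filter, Finset.sum_const, nsmul_eq_mul, mul_comm, hyperbolaCount]

theorem norm_kloostermanSum_mul_le_gcd (m n h : ZMod q) :
    ‖kloostermanSum ZMod.stdAddChar m (n * h)‖ ≤ (q.divisors.card : ℝ) ^ 3 * √(q : ℝ) *
      (Nat.gcd h.val q * Nat.gcd (Nat.gcd m.val n.val) q) := by
  have := norm_kloostermanSum_le (ZMod.isPrimitive_stdAddChar q) m.val (n.val * h.val)
  push_cast at this
  simp only [ZMod.natCast_zmod_val] at this
  refine this.trans ?_
  gcongr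
  have hq : 0 < q := NeZero.pos q
  have hdvd : Nat.gcd (Nat.gcd m.val (n.val * h.val)) q ∣
      Nat.gcd h.val q * Nat.gcd (Nat.gcd m.val n.val) q := by
    set g := Nat.gcd (Nat.gcd m.val (n.val * h.val)) q with hg
    have hgm : g ∣ m.val := (Nat.gcd_dvd_left _ _).trans (Nat.gcd_dvd_left _ _)
    have hgn : g ∣ n.val * h.val := (Nat.gcd_dvd_left _ _).trans (Nat.gcd_dvd_right _ _)
    have hgq : g ∣ q := Nat.gcd_dvd_right _ _
    rw [← Nat.gcd_mul_right]
    refine Nat.dvd_gcd ?_ (hgq.mul_right _)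
    rw [← Nat.gcd_mul_left, ← Nat.gcd_mul_left]
    exact Nat.dvd_gcd (Nat.dvd_gcd (hgm.mul_left _) (mul_comm h.val _ ▸ hgn)) (hgq.mul_left _)
  exact_mod_cast Nat.le_of_dvd (Nat.mul_pos (Nat.gcd_pos_of_pos_right _ hq)
    (Nat.gcd_pos_of_pos_right _ hq)) hdvd

theorem sum_sum_eq_add_sum_erase (F : ZMod q → ZMod q → ℂ) :
    ∑ n, ∑ m, F n m = F 0 0 + ∑ m ∈ Finset.univ.erase 0, F 0 m +
      ∑ n ∈ Finset.univ.erase 0, ∑ m, F n m := by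
  rw [← Finset.add_sum_erase _ _ (Finset.mem_univ (0 : ZMod q)),
    ← Finset.add_sum_erase _ (F 0) (Finset.mem_univ (0 : ZMod q))]

theorem abs_hyperbolaCount_sub_le {A B : Finset (ZMod q)}
    (hA : ∀ m ≠ 0, ‖fourierCoefficient A m‖ ≤ q * frequencyWeight m)
    (hB : ∀ m ≠ 0, ‖fourierCoefficient B m‖ ≤ q * frequencyWeight m) (h : ZMod q) {L : ℝ}
    (hL : ∑ m ∈ Finset.univ.erase (0 : ZMod q), frequencyWeight m * Nat.gcd m.val q ≤ L) :
    |(hyperbolaCount A B h : ℝ) - q.totient / (q : ℝ) ^ 2 * A.card * B.card| ≤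
      (q.divisors.card : ℝ) ^ 3 * √(q : ℝ) * Nat.gcd h.val q * (L * (2 + L)) := by
  have hq : (0 : ℝ) < q := by exact_mod_cast NeZero.pos q
  set K : ℝ := (q.divisors.card : ℝ) ^ 3 * √(q : ℝ) * Nat.gcd h.val q with hKdef
  have hK : 0 ≤ K := by positivity
  have hcard : ∀ A : Finset (ZMod q), ‖fourierCoefficient A 0‖ ≤ q := by
    intro A
    rw [fourierCoefficient_zero, Complex.norm_natCast]
    exact_mod_cast (Finset.card_le_univ A).trans_eq (ZMod.card q)
  have hS : ∀ m n z : ZMod q, Nat.gcd m.val n.val ∣ z.val →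
      ‖kloostermanSum ZMod.stdAddChar m (n * h)‖ ≤ K * Nat.gcd z.val q := by
    intro m n z hz
    refine (norm_kloostermanSum_mul_le_gcd m n h).trans ?_
    rw [← mul_assoc]
    gcongr
    exact Nat.le_of_dvd (Nat.gcd_pos_of_pos_right _ (NeZero.pos q)) (Nat.gcd_dvd_gcd_of_dvd_left _ hz)
  set F : ZMod q → ZMod q → ℂ := fun n m => fourierCoefficient A m * fourierCoefficient B n *
    kloostermanSum ZMod.stdAddChar m (n * h) with hF
  have hmain : F 0 0 = A.card * B.card * q.totient := by
    simp [hF, fourierCoefficient_zero, kloostermanSum, ZMod.card_units_eq_totient]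
  have hrow : ∑ m ∈ Finset.univ.erase 0, ‖F 0 m‖ ≤ (q : ℝ) ^ 2 * K * L := by
    calc _ ≤ ∑ m ∈ Finset.univ.erase (0 : ZMod q),
          (q : ℝ) ^ 2 * K * (frequencyWeight m * Nat.gcd m.val q) := by
          refine Finset.sum_le_sum fun m hm => ?_
          have hm0 := Finset.ne_of_mem_erase hm
          rw [hF, norm_mul, norm_mul]
          calc _ ≤ q * frequencyWeight m * q * (K * Nat.gcd m.val q) :=
                mul_le_mul (mul_le_mul (hA m hm0) (hcard B) (norm_nonneg _)
                  (mul_nonneg hq.le (frequencyWeight_nonneg m)))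
                  (hS m 0 m (Nat.gcd_dvd_left _ _)) (norm_nonneg _)
                  (mul_nonneg (mul_nonneg hq.le (frequencyWeight_nonneg m)) hq.le)
            _ = _ := by ring
      _ ≤ _ := by
          rw [← Finset.mul_sum]
          gcongr
  have hAsum : ∑ m, ‖fourierCoefficient A m‖ ≤ q * (1 + L) := by
    rw [← Finset.add_sum_erase _ _ (Finset.mem_univ (0 : ZMod q)), mul_add, mul_one]
    refine add_le_add (hcard A) (le_trans ?_ (mul_le_mul_of_nonneg_left hL hq.le))
    rw [Finset.mul_sum]
    refine Finset.sum_le_sum fun m hm => (hA m (Finset.ne_of_mem_erase hm)).trans ?_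
    refine mul_le_mul_of_nonneg_left (le_mul_of_one_le_right (frequencyWeight_nonneg m) ?_) hq.le
    exact_mod_cast Nat.gcd_pos_of_pos_right _ (NeZero.pos q)
  have hrest : ∑ n ∈ Finset.univ.erase 0, ∑ m, ‖F n m‖ ≤ (q : ℝ) ^ 2 * K * (L * (1 + L)) := by
    have hL1 : 0 ≤ q * (1 + L) := (Finset.sum_nonneg fun _ _ => norm_nonneg _).trans hAsum
    calc _ ≤ ∑ n ∈ Finset.univ.erase (0 : ZMod q), ∑ m, ‖fourierCoefficient A m‖ *
          (q * K * (frequencyWeight n * Nat.gcd n.val q)) := by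
          refine Finset.sum_le_sum fun n hn => Finset.sum_le_sum fun m _ => ?_
          have hn0 := Finset.ne_of_mem_erase hn
          rw [hF, norm_mul, norm_mul, mul_assoc]
          refine mul_le_mul_of_nonneg_left ?_ (norm_nonneg _)
          calc _ ≤ q * frequencyWeight n * (K * Nat.gcd n.val q) :=
                mul_le_mul (hB n hn0) (hS m n n (Nat.gcd_dvd_right _ _)) (norm_nonneg _)
                  (mul_nonneg hq.le (frequencyWeight_nonneg n))
            _ = _ := by ring
      _ = (∑ m, ‖fourierCoefficient A m‖) * (q * K *
          ∑ n ∈ Finset.univ.erase (0 : ZMod q), frequencyWeight n * Nat.gcd n.val q) := by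
          simp_rw [← Finset.sum_mul, ← Finset.mul_sum]
      _ ≤ (q * (1 + L)) * (q * K * L) := by
          refine mul_le_mul hAsum (mul_le_mul_of_nonneg_left hL (by positivity)) ?_ hL1
          exact mul_nonneg (by positivity) (Finset.sum_nonneg fun m _ =>
            mul_nonneg (frequencyWeight_nonneg m) (Nat.cast_nonneg _))
      _ = _ := by ring
  have hexp := sq_mul_hyperbolaCount A B h
  rw [sum_sum_eq_add_sum_erase F, hmain] at hexp
  have hcast : (((hyperbolaCount A B h : ℝ) - q.totient / (q : ℝ) ^ 2 * A.card * B.card : ℝ) : ℂ) *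
      (q : ℂ) ^ 2 = ∑ m ∈ Finset.univ.erase 0, F 0 m +
      ∑ n ∈ Finset.univ.erase 0, ∑ m, F n m := by
    have hq' : (q : ℂ) ≠ 0 := by exact_mod_cast NeZero.ne q
    push_cast
    field_simp
    linear_combination hexp
  have hnorm := congrArg norm hcast
  rw [norm_mul, Complex.norm_real, Real.norm_eq_abs, norm_pow, Complex.norm_natCast] at hnorm
  refine le_of_mul_le_mul_right ?_ (pow_pos hq 2)
  rw [hnorm]
  calc _ ≤ ∑ m ∈ Finset.univ.erase 0, ‖F 0 m‖ + ∑ n ∈ Finset.univ.erase 0, ∑ m, ‖F n m‖ :=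
        (norm_add_le _ _).trans (add_le_add (norm_sum_le _ _) ((norm_sum_le _ _).trans
          (Finset.sum_le_sum fun n _ => norm_sum_le _ _)))
    _ ≤ (q : ℝ) ^ 2 * K * L + (q : ℝ) ^ 2 * K * (L * (1 + L)) := add_le_add hrow hrest
    _ = _ := by ring

end fourierExpansion

section asymptotics

theorem natCast_injOn_Ico {q c d : ℕ} (hdq : d ≤ q) :
    Set.InjOn (Nat.cast : ℕ → ZMod q) (Finset.Ico c d : Finset ℕ) := by
  intro a ha b hb hab
  have ha' := (Finset.mem_Ico.1 (Finset.mem_coe.1 ha)).2.trans_le hdq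
  have hb' := (Finset.mem_Ico.1 (Finset.mem_coe.1 hb)).2.trans_le hdq
  rw [← ZMod.val_natCast_of_lt ha', ← ZMod.val_natCast_of_lt hb']
  exact congrArg ZMod.val hab

variable {q : ℕ} [NeZero q]

/-- The residues modulo `q` whose least nonnegative representative lies in `I`. -/
noncomputable def residuesIn (q : ℕ) [NeZero q] (I : Set ℝ) : Finset (ZMod q) :=
  Finset.univ.filter fun x => (x.val : ℝ) ∈ I

theorem mem_residuesIn {I : Set ℝ} {x : ZMod q} : x ∈ residuesIn q I ↔ (x.val : ℝ) ∈ I := by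
  simp [residuesIn]

theorem Ncong_eq_hyperbolaCount (h : ℤ) (I1 I2 : Set ℝ) :
    Ncong q h I1 I2 = hyperbolaCount (residuesIn q I1) (residuesIn q I2) (h : ZMod q) := by
  unfold Ncong hyperbolaCount
  symm
  refine Finset.card_bij
    (fun u _ => ((u : ZMod q).val, ((h : ZMod q) * ((u⁻¹ : (ZMod q)ˣ) : ZMod q)).val)) ?_ ?_ ?_
  · intro u hu
    obtain ⟨-, hu1, hu2⟩ := Finset.mem_filter.1 hu
    rw [mem_residuesIn] at hu1 hu2
    refine Finset.mem_filter.2 ⟨Finset.mem_product.2 ⟨Finset.mem_range.2 (ZMod.val_lt _),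
      Finset.mem_range.2 (ZMod.val_lt _)⟩, hu1, hu2, ZMod.val_coe_unit_coprime u, ?_⟩
    rw [← ZMod.intCast_eq_intCast_iff]
    push_cast
    simp only [ZMod.natCast_zmod_val]
    rw [mul_left_comm, Units.mul_inv, mul_one]
  · intro u _ v _ huv
    exact Units.ext (ZMod.val_injective q (Prod.ext_iff.1 huv).1)
  · rintro ⟨x, y⟩ hxy
    obtain ⟨hmem, hx, hy, hcop, hmod⟩ := Finset.mem_filter.1 hxy
    obtain ⟨hxq, hyq⟩ := Finset.mem_product.1 hmem
    rw [Finset.mem_range] at hxq hyq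
    rw [← ZMod.intCast_eq_intCast_iff] at hmod
    push_cast at hmod
    set u := ZMod.unitOfCoprime x hcop with hu
    have hux : (u : ZMod q) = x := ZMod.coe_unitOfCoprime x hcop
    have huy : (h : ZMod q) * ((u⁻¹ : (ZMod q)ˣ) : ZMod q) = y := by
      rw [← hmod, ← hux, mul_right_comm, Units.mul_inv, one_mul]
    have hxv : ((x : ZMod q)).val = x := ZMod.val_natCast_of_lt hxq
    have hyv : ((y : ZMod q)).val = y := ZMod.val_natCast_of_lt hyq
    refine ⟨u, Finset.mem_filter.2 ⟨Finset.mem_univ _, ?_, ?_⟩, ?_⟩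
    · rw [mem_residuesIn, hux, hxv]
      exact hx
    · rw [mem_residuesIn, huy, hyv]
      exact hy
    · rw [hux, huy, hxv, hyv]

theorem residuesIn_eq_image {I : Set ℝ} {c d : ℕ} (hdq : d ≤ q)
    (hI : ∀ x : ℕ, (x : ℝ) ∈ I ↔ c ≤ x ∧ x < d) :
    residuesIn q I = (Finset.Ico c d).image (Nat.cast : ℕ → ZMod q) := by
  ext x
  rw [mem_residuesIn, hI, Finset.mem_image]
  constructor
  · intro hx
    exact ⟨x.val, Finset.mem_Ico.2 hx, ZMod.natCast_zmod_val x⟩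
  · rintro ⟨y, hy, rfl⟩
    obtain ⟨hcy, hyd⟩ := Finset.mem_Ico.1 hy
    rw [ZMod.val_natCast_of_lt (hyd.trans_le hdq)]
    exact ⟨hcy, hyd⟩

theorem abs_card_residuesIn_sub_volume_le {I : Set ℝ} (hI : I.OrdConnected)
    (hIq : I ⊆ Set.Ico 0 (q : ℝ)) :
    |((residuesIn q I).card : ℝ) - (volume I).toReal| ≤ 1 := by
  obtain ⟨c, d, -, hdq, hmem, hvol⟩ := exists_natCast_mem_iff_of_ordConnected hI hIq
  rwa [residuesIn_eq_image hdq hmem, Finset.card_image_of_injOn (natCast_injOn_Ico hdq),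
    Nat.card_Ico]

theorem norm_fourierCoefficient_residuesIn_le {I : Set ℝ} (hI : I.OrdConnected)
    (hIq : I ⊆ Set.Ico 0 (q : ℝ)) (m : ZMod q) (hm : m ≠ 0) :
    ‖fourierCoefficient (residuesIn q I) m‖ ≤ q * frequencyWeight m := by
  obtain ⟨c, d, hcd, hdq, hmem, -⟩ := exists_natCast_mem_iff_of_ordConnected hI hIq
  rw [fourierCoefficient, residuesIn_eq_image hdq hmem, Finset.sum_image (natCast_injOn_Ico hdq)]
  exact norm_sum_Ico_stdAddChar_le hm hcd

theorem gcd_val_intCast (h : ℤ) : Nat.gcd (h : ZMod q).val q = Int.gcd h q := by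
  have h1 : (((h : ZMod q).val : ℕ) : ℤ) = h % q := ZMod.val_intCast h
  rw [← Int.gcd_natCast_natCast, h1, Int.gcd_emod]

theorem abs_totient_main_term_sub_le {I1 I2 : Set ℝ} (hI1 : I1.OrdConnected)
    (hI2 : I2.OrdConnected) (hI1q : I1 ⊆ Set.Ico 0 (q : ℝ)) (hI2q : I2 ⊆ Set.Ico 0 (q : ℝ)) :
    |(q.totient : ℝ) / (q : ℝ) ^ 2 * (residuesIn q I1).card * (residuesIn q I2).card -
      (q.totient : ℝ) / (q : ℝ) ^ 2 * (volume I1).toReal * (volume I2).toReal| ≤ 2 := by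
  have hq : (0 : ℝ) < q := by exact_mod_cast NeZero.pos q
  have h1 := abs_card_residuesIn_sub_volume_le hI1 hI1q
  have h2 := abs_card_residuesIn_sub_volume_le hI2 hI2q
  have hc : ((residuesIn q I1).card : ℝ) ≤ q := by
    exact_mod_cast (Finset.card_le_univ _).trans_eq (ZMod.card q)
  have hv : (volume I2).toReal ≤ q := by
    simpa using toReal_volume_le_of_subset_Icc hq.le (hI2q.trans Set.Ico_subset_Icc_self)
  have hv0 : 0 ≤ (volume I2).toReal := ENNReal.toReal_nonneg
  have htot : (q.totient : ℝ) ≤ q := by exact_mod_cast Nat.totient_le q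
  set a : ℝ := ((residuesIn q I1).card : ℝ)
  set b : ℝ := ((residuesIn q I2).card : ℝ)
  set v := (volume I1).toReal
  set w := (volume I2).toReal
  have ha0 : 0 ≤ a := Nat.cast_nonneg _
  have hdiff : |a * b - v * w| ≤ 2 * q := by
    have : a * b - v * w = a * (b - w) + (a - v) * w := by ring
    rw [this]
    refine (abs_add_le _ _).trans ?_
    rw [abs_mul, abs_mul, abs_of_nonneg ha0, abs_of_nonneg hv0]
    nlinarith [abs_nonneg (b - w), abs_nonneg (a - v)]
  have : (q.totient : ℝ) / (q : ℝ) ^ 2 * a * b - (q.totient : ℝ) / (q : ℝ) ^ 2 * v * w =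
      (q.totient : ℝ) / (q : ℝ) ^ 2 * (a * b - v * w) := by ring
  rw [this, abs_mul, abs_of_nonneg (by positivity), div_mul_eq_mul_div, div_le_iff₀ (by positivity)]
  calc _ ≤ (q : ℝ) * (2 * q) := by gcongr
    _ = _ := by ring

theorem abs_Ncong_sub_le {I1 I2 : Set ℝ} (hI1 : I1.OrdConnected)
    (hI2 : I2.OrdConnected) (hI1q : I1 ⊆ Set.Ico 0 (q : ℝ)) (hI2q : I2 ⊆ Set.Ico 0 (q : ℝ))
    (h : ℤ) {L : ℝ} (hL : 2 * (q.divisors.card * (1 + Real.log q)) ≤ L) :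
    |(Ncong q h I1 I2 : ℝ) -
        (q.totient : ℝ) / (q : ℝ) ^ 2 * (volume I1).toReal * (volume I2).toReal| ≤
      (q.divisors.card : ℝ) ^ 3 * √(q : ℝ) * Int.gcd h q * (L * (2 + L)) + 2 := by
  rw [Ncong_eq_hyperbolaCount, ← gcd_val_intCast (q := q)]
  exact (abs_sub_le _ _ _).trans (add_le_add
    (abs_hyperbolaCount_sub_le (norm_fourierCoefficient_residuesIn_le hI1 hI1q)
      (norm_fourierCoefficient_residuesIn_le hI2 hI2q) _ (sum_frequencyWeight_mul_gcd_le.trans hL))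
    (abs_totient_main_term_sub_le hI1 hI2 hI1q hI2q))

end asymptotics

/-- Proposition A1: for intervals `I₁, I₂ ⊆ [0,q)`, any integer `h` and any `δ > 0`,
`N_{q,h}(I₁,I₂) = (φ(q)/q²)|I₁||I₂| + O_δ(q^{1/2+δ} gcd(h,q))`. -/
theorem congruence_count_asymptotic (δ : ℝ) (hδ : 0 < δ) :
    ∃ C > (0 : ℝ), ∀ q : ℕ, 2 ≤ q →
      ∀ I1 I2 : Set ℝ, I1.OrdConnected → I2.OrdConnected →
      I1 ⊆ Set.Ico 0 (q : ℝ) → I2 ⊆ Set.Ico 0 (q : ℝ) → ∀ h : ℤ,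
      |(Ncong q h I1 I2 : ℝ) -
          (Nat.totient q : ℝ) / (q : ℝ) ^ 2 * (volume I1).toReal * (volume I2).toReal| ≤
        C * (q : ℝ) ^ ((1 / 2 : ℝ) + δ) * (Int.gcd h (q : ℤ) : ℝ) := by
  have hε : 0 < δ / 7 := by positivity
  obtain ⟨D, hD1, hD⟩ := exists_card_divisors_le_rpow hε
  set E : ℝ := 2 * (D * (1 + (δ / 7)⁻¹)) with hE
  have hE0 : 0 < E := by positivity
  refine ⟨D ^ 3 * (E * (2 + E)) + 2, by positivity, ?_⟩
  intro q hq2 I1 I2 hI1 hI2 hI1q hI2q h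
  have : NeZero q := ⟨by omega⟩
  have hq1 : (1 : ℝ) ≤ q := by exact_mod_cast (by omega : 1 ≤ q)
  have hq0 : (0 : ℝ) < q := by linarith
  set x : ℝ := (q : ℝ) ^ (δ / 7) with hx
  have hx1 : 1 ≤ x := Real.one_le_rpow hq1 hε.le
  have hd : (q.divisors.card : ℝ) ≤ D * x := hD q (by omega)
  have hlog : 1 + Real.log q ≤ (1 + (δ / 7)⁻¹) * x := by
    have := Real.log_le_rpow_div hq0.le hε
    rw [← hx, div_eq_mul_inv] at this
    linarith
  have hlog0 : 0 ≤ Real.log q := Real.log_nonneg hq1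
  have hL : 2 * (q.divisors.card * (1 + Real.log q)) ≤ E * x ^ 2 := by
    calc _ ≤ 2 * ((D * x) * ((1 + (δ / 7)⁻¹) * x)) := by gcongr
      _ = _ := by rw [hE]; ring
  have hg : (1 : ℝ) ≤ Int.gcd h (q : ℤ) := by
    exact_mod_cast Int.gcd_pos_of_ne_zero_right h (by omega)
  have hs1 : 1 ≤ √(q : ℝ) := Real.one_le_sqrt.2 hq1
  have hpow : (q : ℝ) ^ ((1 / 2 : ℝ) + δ) = √(q : ℝ) * x ^ 7 := by
    rw [Real.rpow_add hq0, ← Real.sqrt_eq_rpow, hx, ← Real.rpow_mul_natCast hq0.le]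
    congr 2
    push_cast
    ring
  refine (abs_Ncong_sub_le hI1 hI2 hI1q hI2q h hL).trans ?_
  rw [hpow]
  have hx2 : 1 ≤ x ^ 2 := one_le_pow₀ hx1
  have hx7 : 1 ≤ x ^ 7 := one_le_pow₀ hx1
  set g : ℝ := (Int.gcd h (q : ℤ) : ℝ)
  set s := √(q : ℝ)
  have hfirst : (q.divisors.card : ℝ) ^ 3 * s * g * (E * x ^ 2 * (2 + E * x ^ 2)) ≤
      D ^ 3 * (E * (2 + E)) * (s * x ^ 7) * g := by
    calc _ ≤ (D * x) ^ 3 * s * g * (E * x ^ 2 * (2 * x ^ 2 + E * x ^ 2)) := by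
          gcongr
          linarith
      _ = _ := by ring
  have hsecond : (2 : ℝ) ≤ 2 * (s * x ^ 7) * g := by
    have : 1 ≤ s * x ^ 7 * g := one_le_mul_of_one_le_of_one_le
      (one_le_mul_of_one_le_of_one_le hs1 hx7) hg
    linarith
  calc _ ≤ _ := add_le_add hfirst hsecond
    _ = _ := by ring
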